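/- arXiv:1702.00080 — 4 statements merged into one kernel-verified Lean document; each statement's English description precedes it below -/
import Mathlib

section
/- Let k be a field, let d < n be nonnegative integers, let e_0 ≥ e_1 ≥ … ≥ e_d > 0 be integers, set e_i := 0 for d+1 ≤ i ≤ n+1, and let a_j := e_j − e_{j+1} for 0 ≤ j ≤ n−1. Let L := L(a_0, a_1, …, a_{n−1}) ⊆ k[x_0,…,x_n]. Then: (1) L is a lex-segment ideal; (2) L is saturated with respect to ⟨x_0,…,x_n⟩; and (3) the Hilbert polynomial of k[x_0,…,x_n]/L is p(t) = Σ_{i=0}^d [C(t+i, i+1) − C(t+i−e_i, i+1)], i.e., for all sufficiently large i, dim_k (k[x_0,…,x_n]/L)_i = p(i). -/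
/-- The polynomial binomial coefficient `C(t+a, b) ∈ ℚ[t]`. -/
noncomputable def polyBinom (a b : ℤ) : Polynomial ℚ :=
  if 0 ≤ b then
    (Nat.factorial b.toNat : ℚ)⁻¹ •
      (descPochhammer ℚ b.toNat).comp (Polynomial.X + Polynomial.C (a : ℚ))
  else 0

/-- The Macaulay–Hartshorne expression `Σ_{i=0}^d [C(t+i, i+1) − C(t+i−e_i, i+1)]`. -/
noncomputable def mhSum (d : ℕ) (e : Fin (d + 1) → ℤ) : Polynomial ℚ :=
  ∑ i : Fin (d + 1),
    (polyBinom ((i : ℕ) : ℤ) (((i : ℕ) : ℤ) + 1) -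
      polyBinom (((i : ℕ) : ℤ) - e i) (((i : ℕ) : ℤ) + 1))

/-- `I` is saturated with respect to the irrelevant ideal `⟨x_0,…,x_n⟩`: every `f` with
`f·⟨x_0,…,x_n⟩^j ⊆ I` for some `j ≥ 1` lies in `I`. -/
def IsSaturatedIdeal {k : Type*} [Field k] {N : ℕ} (I : Ideal (MvPolynomial (Fin N) k)) : Prop :=
  ∀ f : MvPolynomial (Fin N) k,
    (∃ j : ℕ, 1 ≤ j ∧
      ∀ g ∈ (Ideal.span (Set.range (MvPolynomial.X : Fin N → MvPolynomial (Fin N) k))) ^ j,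
        f * g ∈ I) → f ∈ I

/-- The Hilbert function of `k[x_0,…,x_{N−1}]/I` in degree `i`: the `k`-dimension of the
degree-`i` homogeneous piece modulo the degree-`i` part of `I`. -/
noncomputable def hilbFn {k : Type*} [Field k] {N : ℕ} (I : Ideal (MvPolynomial (Fin N) k))
    (i : ℕ) : ℕ :=
  Module.finrank k
    ((MvPolynomial.homogeneousSubmodule (Fin N) k i) ⧸
      (Submodule.comap (MvPolynomial.homogeneousSubmodule (Fin N) k i).subtype
        (Submodule.restrictScalars k I)))

/-- The sequence `e_0, …, e_d` extended by `e_i := 0` for `i > d`. -/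
def eExt (d : ℕ) (e : Fin (d + 1) → ℤ) (i : ℕ) : ℤ :=
  if h : i ≤ d then e ⟨i, Nat.lt_succ_of_le h⟩ else 0

/-- `a_j := e_j − e_{j+1}` for the extended sequence. -/
def aSeq (d : ℕ) (e : Fin (d + 1) → ℤ) (j : ℕ) : ℕ :=
  (eExt d e j - eExt d e (j + 1)).toNat

/-- The exponent vector of the `m`-th generator (for `0 ≤ m ≤ n−1`) of `L(a_0,…,a_{n−1})`:
for `m < n−1` it is `x_0^{a_{n−1}}⋯x_{m−1}^{a_{n−m}}·x_m^{a_{n−1−m}+1}`, and for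
`m = n−1` it is `x_0^{a_{n−1}}⋯x_{n−2}^{a_1}·x_{n−1}^{a_0}`. -/
noncomputable def lexExp (n : ℕ) (a : ℕ → ℕ) (m : ℕ) : Fin (n + 1) →₀ ℕ :=
  Finsupp.equivFunOnFinite.symm fun t : Fin (n + 1) =>
    if (t : ℕ) < m then a (n - 1 - (t : ℕ))
    else if (t : ℕ) = m then (if m = n - 1 then a 0 else a (n - 1 - m) + 1)
    else 0

/-- The monomial ideal `L(a_0,…,a_{n−1}) ⊆ k[x_0,…,x_n]`. -/
noncomputable def lexIdealGen (k : Type*) [Field k] (n : ℕ) (a : ℕ → ℕ) :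
    Ideal (MvPolynomial (Fin (n + 1)) k) :=
  Ideal.span ((fun m => MvPolynomial.monomial (lexExp n a m) (1 : k)) '' {m : ℕ | m < n})

/-- `u >_lex v`: the first nonzero coordinate of `u − v` is positive. -/
def lexGT {N : ℕ} (u v : Fin N →₀ ℕ) : Prop :=
  ∃ i : Fin N, v i < u i ∧ ∀ j : Fin N, j < i → u j = v j

/-- A lex-segment ideal: whenever a monomial `x^u` lies in `I` and `x^v` is a monomial of
the same degree with `x^v >_lex x^u`, then `x^v ∈ I`. -/
def IsLexSegment {k : Type*} [Field k] {N : ℕ} (I : Ideal (MvPolynomial (Fin N) k)) : Prop :=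
  ∀ u v : Fin N →₀ ℕ, MvPolynomial.monomial u (1 : k) ∈ I →
    (∑ i, u i) = (∑ i, v i) → lexGT v u → MvPolynomial.monomial v (1 : k) ∈ I

/-- The initial segment of the exponent vector `u` is lexicographically smaller than
`(a_{n−1}, …, a_0)`. -/
def LexBelow (n : ℕ) (a : ℕ → ℕ) (u : Fin (n + 1) → ℕ) : Prop :=
  ∃ m : Fin n, (∀ t < m, u t.castSucc = a (n - 1 - t)) ∧ u m.castSucc < a (n - 1 - m)

theorem exists_lexExp_le_iff (n : ℕ) (hn : 0 < n) (a : ℕ → ℕ) (u : Fin (n + 1) →₀ ℕ) :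
    (∃ m < n, lexExp n a m ≤ u) ↔ ¬ LexBelow n a u := by
  constructor
  · rintro ⟨m, hm, hle⟩ ⟨r, hr, hlt⟩
    have key : ∀ t : Fin (n + 1), _ := fun t => hle t
    simp only [lexExp, Finsupp.equivFunOnFinite_symm_apply_apply] at key
    have h1 := key r.castSucc
    simp only [Fin.val_castSucc] at h1
    rcases lt_trichotomy (r : ℕ) m with h | h | h
    · rw [if_pos h] at h1
      omega
    · rw [if_neg (by omega), if_pos h] at h1
      subst h
      split_ifs at h1 with h2
      · rw [h2, Nat.sub_self] at hlt
        omega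
      · omega
    · have h3 := hr ⟨m, hm⟩ h
      have h2 := key (Fin.castSucc ⟨m, hm⟩)
      simp only [Fin.val_castSucc, lt_irrefl, if_true, if_false] at h2 h3
      rw [if_neg (by omega)] at h2
      omega
  · intro h
    by_cases hall : ∀ t : Fin n, u t.castSucc = a (n - 1 - t)
    · refine ⟨n - 1, by omega, fun t => ?_⟩
      simp only [lexExp, Finsupp.equivFunOnFinite_symm_apply_apply]
      rcases lt_trichotomy (t : ℕ) (n - 1) with h1 | h1 | h1
      · rw [if_pos h1]
        exact (hall ⟨t, by omega⟩).ge
      · rw [if_neg (by omega), if_pos h1, if_pos trivial]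
        have ht := hall ⟨t, by omega⟩
        simp only [Fin.castSucc_mk, Fin.eta] at ht
        rw [ht, h1, Nat.sub_self]
      · rw [if_neg (by omega), if_neg (by omega)]
        exact Nat.zero_le _
    · push Not at hall
      obtain ⟨m, hm, hmin⟩ := WellFounded.has_min (wellFounded_lt (α := Fin n))
        {t : Fin n | u t.castSucc ≠ a (n - 1 - t)} hall
      have hmin' : ∀ t < m, u t.castSucc = a (n - 1 - t) := fun t ht => by
        by_contra hne
        exact hmin t hne ht
      have hgt : a (n - 1 - m) < u m.castSucc :=
        lt_of_le_of_ne (not_lt.1 fun hlt => h ⟨m, hmin', hlt⟩) (Ne.symm hm)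
      refine ⟨m, m.2, fun t => ?_⟩
      simp only [lexExp, Finsupp.equivFunOnFinite_symm_apply_apply]
      rcases lt_trichotomy (t : ℕ) m with h1 | h1 | h1
      · rw [if_pos h1]
        exact (hmin' ⟨t, by omega⟩ h1).ge
      · rw [if_neg (by omega), if_pos h1]
        have ht : t = m.castSucc := Fin.ext h1
        subst ht
        split_ifs with h2
        · rw [h2, Nat.sub_self] at hgt
          exact hgt.le
        · exact hgt
      · rw [if_neg (by omega), if_neg (by omega)]
        exact Nat.zero_le _

theorem mem_lexIdealGen_iff (k : Type*) [Field k] (n : ℕ) (hn : 0 < n) (a : ℕ → ℕ)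
    (p : MvPolynomial (Fin (n + 1)) k) :
    p ∈ lexIdealGen k n a ↔ ∀ u ∈ p.support, ¬ LexBelow n a u := by
  have h : lexIdealGen k n a = Ideal.span
      ((fun s => MvPolynomial.monomial s (1 : k)) '' (lexExp n a '' {m : ℕ | m < n})) := by
    rw [Set.image_image]
    rfl
  rw [h, MvPolynomial.mem_ideal_span_monomial_image]
  refine forall₂_congr fun u _ => ?_
  rw [← exists_lexExp_le_iff n hn]
  simp

theorem monomial_mem_lexIdealGen_iff (k : Type*) [Field k] (n : ℕ) (hn : 0 < n) (a : ℕ → ℕ)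
    (u : Fin (n + 1) →₀ ℕ) :
    MvPolynomial.monomial u (1 : k) ∈ lexIdealGen k n a ↔ ¬ LexBelow n a u := by
  classical
  rw [mem_lexIdealGen_iff k n hn, MvPolynomial.support_monomial, if_neg one_ne_zero]
  simp

theorem isLexSegment_lexIdealGen (k : Type*) [Field k] (n : ℕ) (hn : 0 < n) (a : ℕ → ℕ) :
    IsLexSegment (lexIdealGen k n a) := by
  intro u v hu _ hvu
  rw [monomial_mem_lexIdealGen_iff k n hn] at hu ⊢
  rintro ⟨m, hm, hlt⟩
  obtain ⟨i, hi, heq⟩ := hvu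
  apply hu
  rcases lt_trichotomy (i : ℕ) m with h | h | h
  · refine ⟨⟨i, by omega⟩, fun t ht => ?_, ?_⟩
    · rw [← heq t.castSucc ht]
      exact hm t (lt_trans ht h)
    · have := hm ⟨i, by omega⟩ h
      exact this ▸ hi
  · have him : i = m.castSucc := Fin.ext h
    subst him
    exact ⟨m, fun t ht => heq t.castSucc ht ▸ hm t ht, hi.trans hlt⟩
  · refine ⟨m, fun t ht => ?_, ?_⟩
    · rw [← heq t.castSucc (lt_trans (b := m.castSucc) ht h)]
      exact hm t ht
    · rw [← heq m.castSucc h]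
      exact hlt

theorem isSaturatedIdeal_lexIdealGen (k : Type*) [Field k] (n : ℕ) (hn : 0 < n) (a : ℕ → ℕ) :
    IsSaturatedIdeal (lexIdealGen k n a) := by
  rintro f ⟨j, -, hj⟩
  have hf := hj _ (Ideal.pow_mem_pow (Ideal.subset_span (Set.mem_range_self (Fin.last n))) j)
  rw [mem_lexIdealGen_iff k n hn] at hf ⊢
  rintro u hu ⟨m, hm, hlt⟩
  have hne : ∀ t : Fin n, Finsupp.single (Fin.last n) j t.castSucc = 0 := fun t =>
    Finsupp.single_eq_of_ne (Fin.castSucc_lt_last t).ne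
  refine hf (u + Finsupp.single (Fin.last n) j) ?_ ⟨m, fun t ht => ?_, ?_⟩
  · rw [MvPolynomial.mem_support_iff] at hu ⊢
    rwa [MvPolynomial.X_pow_eq_monomial, MvPolynomial.coeff_mul_monomial, mul_one]
  · rw [Finsupp.add_apply, hne, add_zero]
    exact hm t ht
  · rw [Finsupp.add_apply, hne, add_zero]
    exact hlt

open Classical in
theorem hilbFn_lexIdealGen (k : Type*) [Field k] (n : ℕ) (hn : 0 < n) (a : ℕ → ℕ) (i : ℕ) :
    hilbFn (lexIdealGen k n a) i =
      ((Finset.Nat.antidiagonalTuple (n + 1) i).filter (LexBelow n a)).card := by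
  set S := (Finset.Nat.antidiagonalTuple (n + 1) i).filter (LexBelow n a)
  let φ : MvPolynomial.homogeneousSubmodule (Fin (n + 1)) k i →ₗ[k] (S → k) :=
    LinearMap.pi fun s => (MvPolynomial.lcoeff k (Finsupp.equivFunOnFinite.symm s.1)).comp
      (MvPolynomial.homogeneousSubmodule (Fin (n + 1)) k i).subtype
  have hφ : ∀ p s, φ p s = MvPolynomial.coeff (Finsupp.equivFunOnFinite.symm s.1) p.1 :=
    fun _ _ => rfl
  have hker : Submodule.comap (MvPolynomial.homogeneousSubmodule (Fin (n + 1)) k i).subtype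
        (Submodule.restrictScalars k (lexIdealGen k n a)) = LinearMap.ker φ := by
    ext p
    rw [Submodule.mem_comap, Submodule.restrictScalars_mem, mem_lexIdealGen_iff k n hn,
      LinearMap.mem_ker]
    constructor
    · intro h
      ext s
      rw [hφ]
      by_contra hne
      exact h _ (MvPolynomial.mem_support_iff.2 hne) (Finset.mem_filter.1 s.2).2
    · intro h u hu hb
      have hdeg : ∑ t, u t = i := by
        have := p.2 (MvPolynomial.mem_support_iff.1 hu)
        rw [← this, ← Finsupp.degree_eq_sum, Finsupp.degree_eq_weight_one]
        rfl
      have := congrFun h ⟨u, Finset.mem_filter.2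
        ⟨Finset.Nat.mem_antidiagonalTuple.2 hdeg, hb⟩⟩
      rw [hφ, Finsupp.equivFunOnFinite_symm_coe] at this
      refine MvPolynomial.mem_support_iff.1 hu ?_
      exact this
  have hsurj : Function.Surjective φ := by
    intro c
    refine ⟨⟨∑ s : S, MvPolynomial.monomial (Finsupp.equivFunOnFinite.symm s.1) (c s), ?_⟩, ?_⟩
    · refine Submodule.sum_mem _ fun s _ => MvPolynomial.isHomogeneous_monomial _ ?_
      rw [Finsupp.degree_eq_sum]
      exact Finset.Nat.mem_antidiagonalTuple.1 (Finset.mem_filter.1 s.2).1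
    · ext s
      rw [hφ]
      simp [MvPolynomial.coeff_sum, MvPolynomial.coeff_monomial]
  rw [hilbFn, hker, (φ.quotKerEquivOfSurjective hsurj).finrank_eq,
    Module.finrank_fintype_fun_eq_card,
    Fintype.card_coe]

open Classical in
theorem card_filter_antidiagonalTuple_succ (l i : ℕ) (P : (Fin (l + 1) → ℕ) → Prop) :
    ((Finset.Nat.antidiagonalTuple (l + 1) i).filter P).card =
      ∑ c ∈ Finset.range (i + 1),
        ((Finset.Nat.antidiagonalTuple l (i - c)).filter fun v => P (Fin.cons c v)).card := by
  rw [Finset.card_eq_sum_card_fiberwise (f := fun u => u 0) (t := Finset.range (i + 1))]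
  · refine Finset.sum_congr rfl fun c hc => ?_
    rw [Finset.mem_range] at hc
    refine Finset.card_nbij' (fun u => Fin.tail u) (fun v => Fin.cons c v) ?_ ?_ ?_ ?_
    · intro u hu
      simp only [Finset.coe_filter, Finset.mem_filter, Finset.Nat.mem_antidiagonalTuple,
        Set.mem_ofPred_eq, Fin.sum_univ_succ] at hu ⊢
      obtain ⟨⟨hs, hP⟩, rfl⟩ := hu
      rw [Fin.cons_self_tail]
      exact ⟨by simp only [Fin.tail]; omega, hP⟩
    · intro v hv
      simp only [Finset.coe_filter, Finset.mem_filter, Finset.Nat.mem_antidiagonalTuple,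
        Set.mem_ofPred_eq, Fin.sum_univ_succ, Fin.cons_zero, Fin.cons_succ] at hv ⊢
      exact ⟨⟨by omega, hv.2⟩, trivial⟩
    · intro u hu
      simp only [Finset.coe_filter, Finset.mem_filter, Set.mem_ofPred_eq] at hu
      simp only [← hu.2, Fin.cons_self_tail]
    · intro v _
      exact Fin.tail_cons _ _
  · intro u hu
    simp only [Finset.coe_filter, Finset.Nat.mem_antidiagonalTuple, Set.mem_ofPred_eq,
      Fin.sum_univ_succ, Finset.coe_range, Set.mem_Iio] at hu ⊢
    omega

theorem sum_range_choose_sub_add_choose (n i A : ℕ) (hA : A ≤ i + 1) :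
    ∑ c ∈ Finset.range A, (i - c + n).choose n + (i + n + 1 - A).choose (n + 1) =
      (i + n + 1).choose (n + 1) := by
  induction A with
  | zero => simp
  | succ A ih =>
    rw [← ih (by omega), Finset.sum_range_succ, show i + n + 1 - A = (i - A + n) + 1 by omega,
      show i + n + 1 - (A + 1) = i - A + n by omega, Nat.choose_succ_succ, add_assoc]

theorem card_antidiagonalTuple_succ (l i : ℕ) :
    (Finset.Nat.antidiagonalTuple (l + 1) i).card = (i + l).choose l := by
  classical
  induction l generalizing i with
  | zero => simp
  | succ l ih =>
    have h := card_filter_antidiagonalTuple_succ (l + 1) i fun _ => True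
    simp only [Finset.filter_true, ih] at h
    have h' := sum_range_choose_sub_add_choose l i (i + 1) le_rfl
    rw [show i + l + 1 - (i + 1) = l by omega, Nat.choose_succ_self, add_zero] at h'
    rw [h, h']
    rfl

theorem lexBelow_cons (n : ℕ) (a : ℕ → ℕ) (c : ℕ) (v : Fin (n + 1) → ℕ) :
    LexBelow (n + 1) a (Fin.cons c v) ↔ c < a n ∨ (c = a n ∧ LexBelow n a v) := by
  have hs : ∀ t : Fin n, n + 1 - 1 - (t.succ : ℕ) = n - 1 - t := fun t => by
    rw [Fin.val_succ]
    omega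
  rw [LexBelow, Fin.exists_fin_succ]
  refine or_congr ?_ ?_
  · simp
  · simp only [Fin.forall_fin_succ, Fin.castSucc_zero, Fin.cons_zero, Fin.castSucc_succ,
      Fin.cons_succ, Fin.succ_lt_succ_iff, Fin.succ_pos, hs]
    simp [LexBelow, and_assoc]

theorem sum_range_choose_add (n i : ℕ) :
    ∑ j ∈ Finset.range n, (i + j).choose (j + 1) + 1 = (i + n).choose n := by
  induction n with
  | zero => simp
  | succ n ih =>
    rw [Finset.sum_range_succ, ← add_assoc i n 1, Nat.choose_succ_succ, ← ih]
    ring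

open Classical in
theorem card_lexBelow (n : ℕ) (a : ℕ → ℕ) (i : ℕ) (hi : ∑ l ∈ Finset.range n, a l ≤ i) :
    (((Finset.Nat.antidiagonalTuple (n + 1) i).filter (LexBelow n a)).card : ℤ) =
      ∑ j ∈ Finset.range n, (((i + j).choose (j + 1) : ℤ) -
        ((i + j - ∑ l ∈ Finset.Ico j n, a l).choose (j + 1) : ℤ)) := by
  induction n generalizing i with
  | zero => simp [LexBelow]
  | succ n ih =>
    rw [Finset.sum_range_succ] at hi
    have hrec : ((Finset.Nat.antidiagonalTuple (n + 2) i).filter (LexBelow (n + 1) a)).card =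
        ∑ c ∈ Finset.range (a n), (i - c + n).choose n +
          ((Finset.Nat.antidiagonalTuple (n + 1) (i - a n)).filter (LexBelow n a)).card := by
      rw [card_filter_antidiagonalTuple_succ,
        ← Finset.sum_subset (Finset.range_mono (show a n + 1 ≤ i + 1 by omega)),
        Finset.sum_range_succ]
      · congr 1
        · refine Finset.sum_congr rfl fun c hc => ?_
          rw [Finset.mem_range] at hc
          simp only [lexBelow_cons, hc, true_or, Finset.filter_true, card_antidiagonalTuple_succ]
        · simp only [lexBelow_cons, lt_irrefl, false_or, true_and]
      · intro c _ hc
        rw [Finset.mem_range] at hc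
        simp only [lexBelow_cons, show ¬ c < a n by omega, show c ≠ a n by omega, false_and,
          or_self, Finset.filter_false, Finset.card_empty]
    have h1 := sum_range_choose_sub_add_choose n i (a n) (by omega)
    have h2 := sum_range_choose_add n i
    have h3 := sum_range_choose_add n (i - a n)
    rw [show i + n + 1 - a n = (i - a n + n) + 1 by omega, Nat.choose_succ_succ,
      Nat.choose_succ_succ] at h1
    have h4 : ∀ j ∈ Finset.range n, (i + j - ∑ l ∈ Finset.Ico j (n + 1), a l).choose (j + 1) =
        (i - a n + j - ∑ l ∈ Finset.Ico j n, a l).choose (j + 1) := fun j hj => by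
      rw [Finset.sum_Ico_succ_top (Finset.mem_range.1 hj).le]
      congr 1
      omega
    have h5 : i + n - ∑ l ∈ Finset.Ico n (n + 1), a l = i - a n + n := by
      rw [Nat.Ico_succ_singleton, Finset.sum_singleton]
      omega
    rw [hrec, Nat.cast_add, ih (i - a n) (by omega), Finset.sum_range_succ, h5,
      Finset.sum_sub_distrib, Finset.sum_sub_distrib]
    simp only [← Nat.cast_sum, Finset.sum_congr rfl h4]
    zify at h1 h2 h3 ⊢
    linarith

theorem polyBinom_eval (a : ℤ) (b i m : ℕ) (h : (i : ℤ) + a = m) :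
    (polyBinom a ((b : ℤ) + 1)).eval (i : ℚ) = (m.choose (b + 1) : ℚ) := by
  have hb : ((b : ℤ) + 1).toNat = b + 1 := by omega
  have hm : (i : ℚ) + (a : ℚ) = (m : ℚ) := by exact_mod_cast h
  rw [polyBinom, if_pos (by positivity), hb, Polynomial.eval_smul, Polynomial.eval_comp]
  simp only [Polynomial.eval_add, Polynomial.eval_X, Polynomial.eval_C, hm]
  rw [descPochhammer_eval_eq_descFactorial, Nat.descFactorial_eq_factorial_mul_choose,
    Nat.cast_mul, smul_eq_mul, inv_mul_cancel_left₀ (by positivity)]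

theorem eExt_antitone (d : ℕ) (e : Fin (d + 1) → ℤ) (he : Antitone e) (hepos : ∀ i, 0 < e i) :
    Antitone (eExt d e) := by
  intro i j hij
  unfold eExt
  split_ifs with h1 h2 h2
  · exact he hij
  · omega
  · exact (hepos _).le
  · rfl

theorem sum_Ico_aSeq (n d : ℕ) (hdn : d < n) (e : Fin (d + 1) → ℤ) (he : Antitone e)
    (hepos : ∀ i, 0 < e i) (j : ℕ) (hj : j ≤ n) :
    ((∑ l ∈ Finset.Ico j n, aSeq d e l : ℕ) : ℤ) = eExt d e j := by
  have h : ∀ l, ((aSeq d e l : ℕ) : ℤ) = eExt d e l - eExt d e (l + 1) := fun l =>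
    Int.toNat_of_nonneg (sub_nonneg.2 (eExt_antitone d e he hepos (Nat.le_succ l)))
  have hn : eExt d e n = 0 := dif_neg (by omega)
  push_cast
  simp only [h, Finset.sum_Ico_eq_sum_range, add_assoc]
  rw [Finset.sum_range_sub' (fun l => eExt d e (j + l)),
    Nat.add_sub_cancel' hj, hn, add_zero, sub_zero]

theorem card_lexBelow_aSeq_eq_eval_mhSum (n d : ℕ) (hdn : d < n) (e : Fin (d + 1) → ℤ)
    (he : Antitone e) (hepos : ∀ i, 0 < e i) (i : ℕ)
    (hi : ∑ l ∈ Finset.range n, aSeq d e l ≤ i) :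
    ((∑ j ∈ Finset.range n, (((i + j).choose (j + 1) : ℤ) -
        ((i + j - ∑ l ∈ Finset.Ico j n, aSeq d e l).choose (j + 1) : ℤ)) : ℤ) : ℚ) =
      (mhSum d e).eval (i : ℚ) := by
  have hle : ∀ j < n, ∑ l ∈ Finset.Ico j n, aSeq d e l ≤ i := fun j _ =>
    (Finset.sum_le_sum_of_subset fun l hl =>
      Finset.mem_range.2 (Finset.mem_Ico.1 hl).2).trans hi
  rw [mhSum, Polynomial.eval_finsetSum,
    ← Finset.sum_subset (Finset.range_mono (show d + 1 ≤ n by omega)), Finset.sum_range]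
  · push_cast
    refine Finset.sum_congr rfl fun j _ => ?_
    have hjn : (j : ℕ) < n := by omega
    have hs := sum_Ico_aSeq n d hdn e he hepos j hjn.le
    have hej : eExt d e j = e j := dif_pos (by omega)
    have := hle j hjn
    rw [Polynomial.eval_sub, polyBinom_eval _ j i (i + j) (by push_cast; rfl),
      polyBinom_eval _ j i (i + j - ∑ l ∈ Finset.Ico (j : ℕ) n, aSeq d e l) (by omega)]
  · intro j hjn hj
    rw [Finset.mem_range] at hjn hj
    have hs := sum_Ico_aSeq n d hdn e he hepos j hjn.le
    have hej : eExt d e j = 0 := dif_neg (by omega)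
    rw [hej, Nat.cast_eq_zero] at hs
    rw [hs, Nat.sub_zero, sub_self]

/-- `L(a_0,…,a_{n−1})` built from a Macaulay–Hartshorne partition `e_0 ≥ … ≥ e_d > 0`
(with `d < n`, `e_i := 0` for `i > d`, `a_j := e_j − e_{j+1}`) is a lex-segment ideal,
is saturated, and the Hilbert polynomial of its quotient is
`p(t) = Σ_{i=0}^d [C(t+i,i+1) − C(t+i−e_i,i+1)]`. -/
theorem statement_6 (k : Type*) [Field k] (n d : ℕ) (hdn : d < n)
    (e : Fin (d + 1) → ℤ) (he : Antitone e) (hepos : ∀ i, 0 < e i) :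
    IsLexSegment (lexIdealGen k n (aSeq d e)) ∧
    IsSaturatedIdeal (lexIdealGen k n (aSeq d e)) ∧
    (∃ N : ℕ, ∀ i : ℕ, N ≤ i →
      (hilbFn (lexIdealGen k n (aSeq d e)) i : ℚ) = (mhSum d e).eval (i : ℚ)) := by
  have hn : 0 < n := by omega
  refine ⟨isLexSegment_lexIdealGen k n hn _, isSaturatedIdeal_lexIdealGen k n hn _,
    ∑ l ∈ Finset.range n, aSeq d e l, fun i hi => ?_⟩
  rw [hilbFn_lexIdealGen k n hn, ← card_lexBelow_aSeq_eq_eval_mhSum n d hdn e he hepos i hi,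
    ← card_lexBelow n _ i hi, Int.cast_natCast]
end

section
/- Let k be a field, n ≥ 1, and let I ⊆ k[x_0,…,x_n] be a saturated Borel monomial ideal. Let ∇(I) ⊆ k[x_0,…,x_{n−1}] be the ideal generated by the image of I under the k-algebra homomorphism k[x_0,…,x_n] → k[x_0,…,x_{n−1}] sending x_j ↦ x_j for 0 ≤ j ≤ n−2 and x_{n−1} ↦ 1, x_n ↦ 1. Then the Hilbert polynomial q of k[x_0,…,x_{n−1}]/∇(I) satisfies q(t) = p(t) − p(t−1), where p is the Hilbert polynomial of k[x_0,…,x_n]/I. -/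
/-- A monomial ideal: an ideal generated by a set of monomials. -/
def IsMonomialIdeal {k : Type*} [Field k] {N : ℕ} (I : Ideal (MvPolynomial (Fin N) k)) : Prop :=
  ∃ S : Set (Fin N →₀ ℕ), I = Ideal.span ((fun u => MvPolynomial.monomial u (1 : k)) '' S)

/-- `I` is Borel (strongly stable): for every monomial `x^u ∈ I`, every `j` with
`x_j ∣ x^u`, and every `i < j`, the monomial `x^u·x_i/x_j` lies in `I`. -/
def IsBorel {k : Type*} [Field k] {N : ℕ} (I : Ideal (MvPolynomial (Fin N) k)) : Prop :=
  ∀ u : Fin N →₀ ℕ, MvPolynomial.monomial u (1 : k) ∈ I →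
    ∀ j : Fin N, u j ≠ 0 → ∀ i : Fin N, i < j →
      MvPolynomial.monomial (u - Finsupp.single j 1 + Finsupp.single i 1) (1 : k) ∈ I

namespace MonomialIdeal

open MvPolynomial Finset

variable {k : Type*} [Field k]

open scoped Classical in
/-- The exponents of the degree-`i` monomials outside `I`. -/
noncomputable def standardExponents {N : ℕ} (I : Ideal (MvPolynomial (Fin N) k)) (i : ℕ) :
    Finset (Fin N →₀ ℕ) :=
  {u ∈ finsuppAntidiag univ i | monomial u (1 : k) ∉ I}

theorem mem_standardExponents {N : ℕ} {I : Ideal (MvPolynomial (Fin N) k)} {i : ℕ}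
    {u : Fin N →₀ ℕ} :
    u ∈ standardExponents I i ↔ u.degree = i ∧ monomial u (1 : k) ∉ I := by
  simp [standardExponents, Finsupp.degree_eq_sum]

theorem mem_iff_support {N : ℕ} {I : Ideal (MvPolynomial (Fin N) k)}
    (hI : IsMonomialIdeal I) (f : MvPolynomial (Fin N) k) :
    f ∈ I ↔ ∀ u ∈ f.support, monomial u (1 : k) ∈ I := by
  obtain ⟨S, rfl⟩ := hI
  simp [mem_ideal_span_monomial_image]

theorem monomial_mem_of_le {N : ℕ} {I : Ideal (MvPolynomial (Fin N) k)} {u v : Fin N →₀ ℕ}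
    (huv : u ≤ v) (hu : monomial u (1 : k) ∈ I) : monomial v (1 : k) ∈ I :=
  I.mem_of_dvd (monomial_dvd_monomial.2 ⟨Or.inr huv, dvd_rfl⟩) hu

theorem hilbFn_eq_card {N : ℕ} {I : Ideal (MvPolynomial (Fin N) k)}
    (hI : IsMonomialIdeal I) (i : ℕ) : hilbFn I i = #(standardExponents I i) := by
  let L : homogeneousSubmodule (Fin N) k i →ₗ[k] (standardExponents I i → k) :=
    LinearMap.pi fun u => (lcoeff k u.1).comp (Submodule.subtype _)
  have hL : ∀ f u, L f u = coeff u.1 f.1 := fun _ _ => rfl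
  have hker : Submodule.comap (homogeneousSubmodule (Fin N) k i).subtype
      (Submodule.restrictScalars k I) = LinearMap.ker L := by
    ext f
    rw [Submodule.mem_comap, Submodule.restrictScalars_mem, Submodule.subtype_apply,
      mem_iff_support hI]
    simp only [LinearMap.mem_ker, _root_.funext_iff, hL, Pi.zero_apply, Subtype.forall,
      mem_standardExponents, mem_support_iff]
    refine ⟨fun h u hu => by_contra fun h' => hu.2 (h u h'), fun h u hu => ?_⟩
    by_contra hmem
    refine hu (h u ⟨?_, hmem⟩)
    by_contra hd
    exact hu (IsHomogeneous.coeff_eq_zero ((mem_homogeneousSubmodule i f.1).1 f.2) hd)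
  have hsurj : Function.Surjective L := by
    intro c
    refine ⟨⟨∑ u, monomial u.1 (c u), Submodule.sum_mem _ fun u _ =>
      isHomogeneous_monomial _ (mem_standardExponents.1 u.2).1⟩, ?_⟩
    ext u
    simp [hL, coeff_sum, coeff_monomial]
  rw [hilbFn, hker, (L.quotKerEquivOfSurjective hsurj).finrank_eq,
    Module.finrank_fintype_fun_eq_card, Fintype.card_coe]

theorem exists_finset_span {N : ℕ} {I : Ideal (MvPolynomial (Fin N) k)}
    (hI : IsMonomialIdeal I) :
    ∃ S : Finset (Fin N →₀ ℕ),
      I = Ideal.span ((fun u => monomial u (1 : k)) '' (S : Set (Fin N →₀ ℕ))) := by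
  classical
  obtain ⟨S, rfl⟩ := hI
  obtain ⟨T, hT, hspan⟩ := (Submodule.fg_span_iff_fg_span_finset_subset _).1
    (IsNoetherian.noetherian (Ideal.span ((fun u => monomial u (1 : k)) '' S)))
  obtain ⟨T', -, rfl⟩ := Finset.subset_set_image_iff.1 hT
  exact ⟨T', by simpa using hspan⟩

section Saturated

variable {n : ℕ} {I : Ideal (MvPolynomial (Fin (n + 1)) k)}

theorem monomial_mem_of_add_last_mem (hborel : IsBorel I) (hsat : IsSaturatedIdeal I)
    {u : Fin (n + 1) →₀ ℕ} (hu : monomial (u + Finsupp.single (Fin.last n) 1) (1 : k) ∈ I) :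
    monomial u (1 : k) ∈ I := by
  refine hsat _ ⟨1, le_rfl, fun g hg => ?_⟩
  rw [pow_one] at hg
  induction hg using Submodule.span_induction with
  | mem x hx =>
    obtain ⟨i, rfl⟩ := hx
    rw [X, monomial_mul, one_mul]
    rcases (Fin.le_last i).eq_or_lt with rfl | hi
    · exact hu
    · simpa using hborel _ hu (Fin.last n) (by simp) i hi
  | zero => simp
  | add x y _ _ hx hy => rw [mul_add]; exact I.add_mem hx hy
  | smul a x _ hx => rw [smul_eq_mul, mul_left_comm]; exact I.mul_mem_left _ hx

theorem card_standardExponents_succ (hborel : IsBorel I) (hsat : IsSaturatedIdeal I) (i : ℕ) :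
    #(standardExponents I (i + 1)) = #(standardExponents I i) +
      #{u ∈ standardExponents I (i + 1) | u (Fin.last n) = 0} := by
  rw [← card_filter_add_card_filter_not (s := standardExponents I (i + 1))
    (fun u => u (Fin.last n) = 0), add_comm]
  congr 1
  symm
  refine card_nbij' (· + Finsupp.single (Fin.last n) 1) (· - Finsupp.single (Fin.last n) 1)
    ?_ ?_ ?_ ?_
  · intro u hu
    simp only [mem_coe, mem_standardExponents, mem_filter] at hu ⊢
    refine ⟨⟨by simp [hu.1], fun h => hu.2 (monomial_mem_of_add_last_mem hborel hsat h)⟩,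
      by simp⟩
  · intro u hu
    simp only [mem_coe, mem_standardExponents, mem_filter] at hu ⊢
    obtain ⟨⟨hd, hu⟩, h0⟩ := hu
    have hle : Finsupp.single (Fin.last n) 1 ≤ u := by
      simpa [Finsupp.single_le_iff] using Nat.one_le_iff_ne_zero.2 h0
    refine ⟨?_, fun h => hu (monomial_mem_of_le tsub_le_self h)⟩
    rw [← tsub_add_cancel_of_le hle] at hd
    simpa using hd
  · intro u _
    simp
  · intro u hu
    simp only [mem_coe, mem_filter] at hu
    refine tsub_add_cancel_of_le ?_
    simpa [Finsupp.single_le_iff] using Nat.one_le_iff_ne_zero.2 hu.2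

/-- Borel moves carry a monomial of `I` to any monomial of at least the same degree that does not
involve the last variable and agrees with or exceeds it outside the last two variables. -/
theorem monomial_mem_of_borel (hborel : IsBorel I) {u v : Fin (n + 1) →₀ ℕ}
    (hu : monomial u (1 : k) ∈ I) (hv : v (Fin.last n) = 0)
    (huv : ∀ j : Fin (n + 1), (j : ℕ) < n - 1 → u j ≤ v j) (hd : u.degree ≤ v.degree) :
    monomial v (1 : k) ∈ I := by
  induction hs : ∑ j, (u j - v j) using Nat.strong_induction_on generalizing u with
  | _ s ih =>
  by_cases hle : u ≤ v
  · exact monomial_mem_of_le hle hu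
  obtain ⟨j, hj⟩ : ∃ j, v j < u j := by simpa [Finsupp.le_def] using hle
  obtain ⟨i, hi⟩ : ∃ i, u i < v i := by
    by_contra! h
    rw [Finsupp.degree_eq_sum, Finsupp.degree_eq_sum] at hd
    exact absurd (Finset.sum_lt_sum (fun i _ => h i) ⟨j, mem_univ j, hj⟩) (by omega)
  have hin : i ≠ Fin.last n := by rintro rfl; omega
  have hjn : ¬ (j : ℕ) < n - 1 := fun h => absurd (huv j h) (by omega)
  have hne : i ≠ j := by rintro rfl; omega
  have hij : i < j := by
    have h1 : (i : ℕ) ≠ n := fun h => hin (Fin.ext h)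
    have h2 : (i : ℕ) ≠ j := fun h => hne (Fin.ext h)
    rw [Fin.lt_def]
    omega
  have hle' : Finsupp.single j 1 ≤ u := by
    rw [Finsupp.single_le_iff]; omega
  have happ : ∀ l, (u - Finsupp.single j 1 + Finsupp.single i 1 : Fin (n + 1) →₀ ℕ) l =
      u l - (if j = l then 1 else 0) + (if i = l then 1 else 0) := by
    intro l
    simp [Finsupp.single_apply]
  refine ih _ ?_ (hborel u hu j (by omega) i hij) ?_ ?_ rfl
  · rw [← hs]
    refine Finset.sum_lt_sum (fun l _ => ?_) ⟨j, mem_univ j, ?_⟩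
    · rw [happ]
      split_ifs <;> subst_vars <;> omega
    · rw [happ, if_pos rfl, if_neg hne]
      omega
  · intro l hl
    have := huv l hl
    rw [happ]
    split_ifs <;> subst_vars <;> omega
  · have h1 := congrArg Finsupp.degree (tsub_add_cancel_of_le hle')
    simp only [map_add, Finsupp.degree_single] at h1 ⊢
    omega

end Saturated

section Nabla

variable {n : ℕ}

/-- Forget the last coordinate of an exponent and replace the one before it by zero. -/
noncomputable def truncate (u : Fin (n + 1) →₀ ℕ) : Fin n →₀ ℕ :=
  Finsupp.equivFunOnFinite.symm fun j => if (j : ℕ) < n - 1 then u j.castSucc else 0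

theorem truncate_apply (u : Fin (n + 1) →₀ ℕ) (j : Fin n) :
    truncate u j = if (j : ℕ) < n - 1 then u j.castSucc else 0 := rfl

/-- Append a zero coordinate to an exponent. -/
noncomputable def appendZero (v : Fin n →₀ ℕ) : Fin (n + 1) →₀ ℕ :=
  Finsupp.equivFunOnFinite.symm (Fin.snoc (α := fun _ => ℕ) v 0)

@[simp]
theorem appendZero_castSucc (v : Fin n →₀ ℕ) (j : Fin n) : appendZero v j.castSucc = v j := by
  simp [appendZero]

@[simp]
theorem appendZero_last (v : Fin n →₀ ℕ) : appendZero v (Fin.last n) = 0 := by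
  simp [appendZero]

theorem degree_appendZero (v : Fin n →₀ ℕ) : (appendZero v).degree = v.degree := by
  simp [Finsupp.degree_eq_sum, Fin.sum_univ_castSucc]

/-- The ideal `∇(I)`. -/
noncomputable abbrev nabla (I : Ideal (MvPolynomial (Fin (n + 1)) k)) :
    Ideal (MvPolynomial (Fin n) k) :=
  Ideal.map (MvPolynomial.aeval fun j : Fin (n + 1) =>
    if _h : (j : ℕ) < n - 1 then (MvPolynomial.X (⟨(j : ℕ), by omega⟩ : Fin n) :
      MvPolynomial (Fin n) k) else 1) I

theorem aeval_monomial_eq_truncate (u : Fin (n + 1) →₀ ℕ) :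
    MvPolynomial.aeval (fun j : Fin (n + 1) =>
      if _h : (j : ℕ) < n - 1 then (MvPolynomial.X (⟨(j : ℕ), by omega⟩ : Fin n) :
        MvPolynomial (Fin n) k) else 1) (monomial u (1 : k)) = monomial (truncate u) 1 := by
  rw [aeval_monomial, map_one, one_mul, Finsupp.prod_fintype _ _ (by simp),
    Fin.prod_univ_castSucc, monomial_eq, map_one, one_mul, Finsupp.prod_fintype _ _ (by simp),
    dif_neg (by simp), one_pow, mul_one]
  refine Finset.prod_congr rfl fun j _ => ?_
  by_cases h : (j : ℕ) < n - 1 <;> simp [truncate_apply, h]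

theorem nabla_span (S : Set (Fin (n + 1) →₀ ℕ)) :
    nabla (Ideal.span ((fun u => monomial u (1 : k)) '' S)) =
      Ideal.span ((fun u => monomial u (1 : k)) '' (truncate '' S)) := by
  rw [nabla, Ideal.map_span, Set.image_image, Set.image_image]
  simp only [aeval_monomial_eq_truncate]

theorem isMonomialIdeal_nabla {I : Ideal (MvPolynomial (Fin (n + 1)) k)}
    (hI : IsMonomialIdeal I) : IsMonomialIdeal (nabla I) := by
  obtain ⟨S, rfl⟩ := hI
  exact ⟨_, nabla_span S⟩

/-- In large degree, the monomials of `∇(I)` are the monomials of `I` free of the last variable. -/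
theorem exists_monomial_mem_nabla_iff {I : Ideal (MvPolynomial (Fin (n + 1)) k)}
    (hI : IsMonomialIdeal I) (hborel : IsBorel I) :
    ∃ D : ℕ, ∀ v : Fin n →₀ ℕ, D ≤ v.degree →
      (monomial v (1 : k) ∈ nabla I ↔ monomial (appendZero v) (1 : k) ∈ I) := by
  obtain ⟨S, hS⟩ := exists_finset_span hI
  refine ⟨S.sup Finsupp.degree, fun v hv => ⟨fun h => ?_, fun h => ?_⟩⟩
  · rw [hS, nabla_span, mem_ideal_span_monomial_image] at h
    obtain ⟨_, ⟨u, hu, rfl⟩, huv⟩ := h v (by simp)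
    refine monomial_mem_of_borel hborel (u := u) ?_ (by simp) ?_ ?_
    · rw [hS]
      exact Ideal.subset_span ⟨u, hu, rfl⟩
    · intro j hj
      obtain ⟨j, rfl⟩ := Fin.exists_castSucc_eq.2 (show j ≠ Fin.last n by
        rintro rfl; simp at hj; omega)
      have := huv j
      rw [truncate_apply, if_pos (by simpa using hj)] at this
      simpa using this
    · rw [degree_appendZero]
      exact (Finset.le_sup (f := Finsupp.degree) hu).trans hv
  · have h' := Ideal.mem_map_of_mem (MvPolynomial.aeval fun j : Fin (n + 1) =>
      if _h : (j : ℕ) < n - 1 then (MvPolynomial.X (⟨(j : ℕ), by omega⟩ : Fin n) :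
        MvPolynomial (Fin n) k) else 1) h
    rw [aeval_monomial_eq_truncate] at h'
    refine monomial_mem_of_le (fun j => ?_) h'
    rw [truncate_apply]
    split_ifs <;> simp

theorem exists_card_standardExponents_nabla {I : Ideal (MvPolynomial (Fin (n + 1)) k)}
    (hI : IsMonomialIdeal I) (hborel : IsBorel I) :
    ∃ D : ℕ, ∀ i, D ≤ i → #(standardExponents (nabla I) i) =
      #{u ∈ standardExponents I i | u (Fin.last n) = 0} := by
  obtain ⟨D, hD⟩ := exists_monomial_mem_nabla_iff hI hborel
  refine ⟨D, fun i hi => card_bij (fun v _ => appendZero v) ?_ ?_ ?_⟩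
  · intro v hv
    rw [mem_standardExponents] at hv
    rw [mem_filter, mem_standardExponents, degree_appendZero, ← hD v (by omega)]
    exact ⟨hv, appendZero_last v⟩
  · intro v _ w _ h
    ext j
    simpa using DFunLike.congr_fun h j.castSucc
  · intro u hu
    rw [mem_filter, mem_standardExponents] at hu
    have hv : appendZero (Finsupp.equivFunOnFinite.symm fun j => u j.castSucc) = u := by
      ext j
      cases j using Fin.lastCases with
      | last => simp [hu.2]
      | cast j => simp
    refine ⟨_, ?_, hv⟩
    have hdeg := degree_appendZero (Finsupp.equivFunOnFinite.symm fun j => u j.castSucc)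
    rw [hv] at hdeg
    rw [mem_standardExponents, hD _ (by omega), hv]
    exact ⟨by omega, hu.1.2⟩

end Nabla

end MonomialIdeal

/-- If `I ⊆ k[x_0,…,x_n]` is a saturated Borel monomial ideal with Hilbert polynomial `p`,
then the Hilbert polynomial of `k[x_0,…,x_{n−1}]/∇(I)` is `q(t) = p(t) − p(t−1)`, where
`∇(I)` is the image of `I` under `x_j ↦ x_j` (`j ≤ n−2`), `x_{n−1} ↦ 1`, `x_n ↦ 1`. -/
theorem statement_12 (k : Type*) [Field k] (n : ℕ) (hn : 1 ≤ n)
    (I : Ideal (MvPolynomial (Fin (n + 1)) k))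
    (hmon : IsMonomialIdeal I) (hborel : IsBorel I) (hsat : IsSaturatedIdeal I)
    (p : Polynomial ℚ)
    (hp : ∃ N : ℕ, ∀ i : ℕ, N ≤ i → (hilbFn I i : ℚ) = p.eval (i : ℚ)) :
    ∃ N : ℕ, ∀ i : ℕ, N ≤ i →
      (hilbFn (Ideal.map (MvPolynomial.aeval fun j : Fin (n + 1) =>
          if _h : (j : ℕ) < n - 1 then (MvPolynomial.X (⟨(j : ℕ), by omega⟩ : Fin n) :
            MvPolynomial (Fin n) k) else 1) I) i : ℚ)
        = (p - p.comp (Polynomial.X - Polynomial.C 1)).eval (i : ℚ) := by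
  obtain ⟨N, hN⟩ := hp
  obtain ⟨D, hD⟩ := MonomialIdeal.exists_card_standardExponents_nabla hmon hborel
  refine ⟨max (N + 1) D, fun i hi => ?_⟩
  obtain ⟨i, rfl⟩ : ∃ m, i = m + 1 := ⟨i - 1, by omega⟩
  rw [MonomialIdeal.hilbFn_eq_card (MonomialIdeal.isMonomialIdeal_nabla hmon), hD _ (by omega)]
  have hsucc := MonomialIdeal.card_standardExponents_succ hborel hsat i
  rw [← MonomialIdeal.hilbFn_eq_card hmon, ← MonomialIdeal.hilbFn_eq_card hmon] at hsucc
  have hsucc' := congrArg (Nat.cast : ℕ → ℚ) hsucc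
  rw [Nat.cast_add, hN _ (by omega), hN _ (by omega)] at hsucc'
  simp only [Polynomial.eval_sub, Polynomial.eval_comp, Polynomial.eval_X, Polynomial.eval_C]
  rw [hsucc']
  push_cast
  ring_nf
end

section
/- Let k be a field and I ⊆ k[x_0,…,x_n] a saturated Borel monomial ideal whose Hilbert polynomial has Gotzmann partition (b_1,…,b_r). Then there exists m ∈ ℕ such that the Hilbert polynomial of k[x_0,…,x_{n+1}]/(I·k[x_0,…,x_{n+1}]) equals m + Σ_{j=1}^r C(t + (b_j+1) − (j−1), b_j+1). -/
/-- The Gotzmann expression `Σ_{j=1}^r C(t + b_j − (j−1), b_j)`. -/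
noncomputable def gotzmannSum (r : ℕ) (b : Fin r → ℤ) : Polynomial ℚ :=
  ∑ j : Fin r, polyBinom (b j - ((j : ℕ) : ℤ)) (b j)

/-! ### Degree-graded collections of cones -/

/-- `levelSum c L t` is the sum of `C(t - d + e + c, e + c)` over all `d` and all `e` in the
`d`-th entry of `L`. -/
def levelSum (c : ℕ) : List (Multiset ℕ) → ℤ → ℤ
  | [], _ => 0
  | A :: L, t =>
      (A.map fun e => Ring.choose (t + ((e + c : ℕ) : ℤ)) (e + c)).sum + levelSum c L (t - 1)

/-- The dimensions of the cones of the next degree obtained by splitting cones of dimensions `A`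
along all of their variables. -/
def splitCones (A : Multiset ℕ) : Multiset ℕ :=
  A.bind fun e => Multiset.range (e + 1)

/-- Every element of `B` is bounded by some element of `A`. -/
def IsDominatedBy (A B : Multiset ℕ) : Prop :=
  ∀ e ∈ B, ∃ e' ∈ A, e ≤ e'

theorem choose_eq_sum_range (t : ℤ) (e : ℕ) :
    Ring.choose (t + (e : ℤ)) e
      = ∑ f ∈ Finset.range (e + 1), Ring.choose (t - 1 + (f : ℤ)) f := by
  induction e generalizing t with
  | zero => simp
  | succ e ih =>
    rw [Finset.sum_range_succ, ← ih]
    have h := Ring.choose_succ_succ (t + (e : ℤ)) e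
    push_cast
    rw [show t + ((e : ℤ) + 1) = t + e + 1 by ring, show t - 1 + ((e : ℤ) + 1) = t + e by ring, h]

theorem sum_map_splitCones (A : Multiset ℕ) (t : ℤ) :
    (A.map fun e => Ring.choose (t + ((e + 0 : ℕ) : ℤ)) (e + 0)).sum
      = ((splitCones A).map fun e => Ring.choose (t - 1 + ((e + 0 : ℕ) : ℤ)) (e + 0)).sum := by
  induction A using Multiset.induction_on with
  | empty => simp [splitCones]
  | cons a A ih =>
    simp only [splitCones, Multiset.cons_bind, Multiset.map_add, Multiset.sum_add,
      Multiset.map_cons, Multiset.sum_cons] at ih ⊢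
    rw [ih]
    congr 1
    exact choose_eq_sum_range t a

theorem sum_map_splitCones_succ (A : Multiset ℕ) (t : ℤ) :
    (A.map fun e => Ring.choose (t + ((e + 1 : ℕ) : ℤ)) (e + 1)).sum
      = ((splitCones A).map fun e => Ring.choose (t - 1 + ((e + 1 : ℕ) : ℤ)) (e + 1)).sum
        + A.card := by
  induction A using Multiset.induction_on with
  | empty => simp [splitCones]
  | cons a A ih =>
    simp only [splitCones, Multiset.cons_bind, Multiset.map_add, Multiset.sum_add,
      Multiset.map_cons, Multiset.sum_cons, Multiset.card_cons] at ih ⊢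
    rw [ih, choose_eq_sum_range t (a + 1), Finset.sum_range_succ']
    simp only [Nat.cast_zero, add_zero, Ring.choose_zero_right]
    have : (Multiset.map (fun e => Ring.choose (t - 1 + ((e + 1 : ℕ) : ℤ)) (e + 1))
      (Multiset.range (a + 1))).sum =
        ∑ k ∈ Finset.range (a + 1), Ring.choose (t - 1 + ((k + 1 : ℕ) : ℤ)) (k + 1) := rfl
    rw [this]
    push_cast
    ring

theorem levelSum_add_cons (c : ℕ) (B A : Multiset ℕ) (L : List (Multiset ℕ)) (t : ℤ) :
    levelSum c ((B + A) :: L) t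
      = (B.map fun e => Ring.choose (t + ((e + c : ℕ) : ℤ)) (e + c)).sum
        + levelSum c (A :: L) t := by
  simp [levelSum, add_assoc]

theorem levelSum_eq_zero (c : ℕ) (L : List (Multiset ℕ)) (h : ∀ A ∈ L, A = 0) (t : ℤ) :
    levelSum c L t = 0 := by
  induction L generalizing t with
  | nil => rfl
  | cons A L ih =>
    have hA : A = 0 := h A (by simp)
    subst hA
    simpa [levelSum] using ih (fun B hB => h B (by simp [hB])) (t - 1)

theorem mem_splitCones {A : Multiset ℕ} {x : ℕ} : x ∈ splitCones A ↔ ∃ e ∈ A, x ≤ e := by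
  simp only [splitCones, Multiset.mem_bind, Multiset.mem_range, Nat.lt_succ_iff]

theorem splitCones_eq (A : Multiset ℕ) :
    splitCones A = A + A.bind fun e => Multiset.range e := by
  induction A using Multiset.induction_on with
  | empty => simp [splitCones]
  | cons a A ih =>
    simp only [splitCones, Multiset.cons_bind] at ih ⊢
    rw [ih, Multiset.range_succ]
    simp only [← Multiset.singleton_add]
    abel

/-- Splitting all but one cone of maximal dimension in the lowest degree, degree after degree,
turns a collection of cones into one with a single cone in each degree. -/
theorem exists_list_levelSum_eq (L : List (Multiset ℕ)) (hL : L.Pairwise IsDominatedBy) :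
    ∃ bs : List ℕ, bs.Pairwise (· ≥ ·) ∧ (∀ x ∈ bs, ∃ e ∈ L.sum, x ≤ e) ∧
      (∀ t, levelSum 0 L t = levelSum 0 (bs.map fun x => {x}) t) ∧
      ∃ m : ℕ, ∀ t, levelSum 1 L t = levelSum 1 (bs.map fun x => {x}) t + m := by
  generalize hT : L.sum = T
  induction T using (Multiset.wellFounded_isDershowitzMannaLT (α := ℕ)).induction generalizing L with
  | _ T ih =>
  subst hT
  by_cases h0 : ∀ A ∈ L, A = 0
  · exact ⟨[], by simp, by simp, fun t => levelSum_eq_zero 0 L h0 t,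
      0, fun t => by simpa [levelSum] using levelSum_eq_zero 1 L h0 t⟩
  match L, hL with
  | [], _ => simp at h0
  | A :: L, hL =>
  rw [List.pairwise_cons] at hL
  obtain ⟨hAL, hL⟩ := hL
  have hA : A ≠ 0 := by
    rintro rfl
    apply h0
    intro B hB
    rcases List.mem_cons.1 hB with rfl | hB
    · rfl
    · exact Multiset.eq_zero_of_forall_notMem fun e he => by simpa using hAL B hB e he
  obtain ⟨b, hbA, hbmax⟩ : ∃ b ∈ A, ∀ e ∈ A, e ≤ b := by
    have := A.toFinset.exists_max_image id (by simpa [Finset.nonempty_iff_ne_empty] using hA)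
    simpa using this
  obtain ⟨A', rfl⟩ := Multiset.exists_cons_of_mem hbA
  obtain ⟨L', hL', hsum, hval0, hval1⟩ : ∃ L' : List (Multiset ℕ), L'.Pairwise IsDominatedBy ∧
      L'.sum = splitCones A' + L.sum ∧
      (∀ t, levelSum 0 L' t = levelSum 0 [splitCones A'] t + levelSum 0 L t) ∧
      (∀ t, levelSum 1 L' t = levelSum 1 [splitCones A'] t + levelSum 1 L t) := by
    match L, hL with
    | [], _ => exact ⟨[splitCones A'], by simp, by simp, by simp [levelSum], by simp [levelSum]⟩
    | B :: L, hL =>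
      refine ⟨(splitCones A' + B) :: L, ?_, by simp [add_assoc], fun t => ?_, fun t => ?_⟩
      · rw [List.pairwise_cons] at hL ⊢
        refine ⟨fun C hC e he => ?_, hL.2⟩
        obtain ⟨e', he', hle⟩ := hL.1 C hC e he
        exact ⟨e', by simp [he'], hle⟩
      all_goals rw [levelSum_add_cons]; simp [levelSum]
  have hle : ∀ e ∈ ((b ::ₘ A') :: L).sum, e ≤ b := by
    intro e he
    have key : ∀ M : List (Multiset ℕ), (∀ B ∈ M, ∀ x ∈ B, x ≤ b) → ∀ x ∈ M.sum, x ≤ b := by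
      intro M
      induction M with
      | nil => simp
      | cons B M ihM =>
        intro h x hx
        rw [List.sum_cons, Multiset.mem_add] at hx
        rcases hx with hx | hx
        · exact h B (by simp) x hx
        · exact ihM (fun C hC => h C (by simp [hC])) x hx
    refine key _ ?_ e he
    intro B hB x hx
    rcases List.mem_cons.1 hB with rfl | hB
    · exact hbmax x hx
    · obtain ⟨e', he', h⟩ := hAL B hB x hx
      exact h.trans (hbmax e' he')
  obtain ⟨bs, hbs, hbd, hv0, m, hv1⟩ := ih L'.sum (by
    refine ⟨A' + L.sum, A'.bind fun e => Multiset.range e, {b}, by simp, ?_, ?_, ?_⟩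
    · rw [hsum, splitCones_eq]; abel
    · rw [List.sum_cons, ← Multiset.singleton_add]; abel
    · intro y hy
      simp only [Multiset.mem_bind, Multiset.mem_range] at hy
      obtain ⟨e, he, hye⟩ := hy
      exact ⟨b, by simp, hye.trans_le (hbmax e (by simp [he]))⟩) L' hL' rfl
  have hbd' : ∀ x ∈ bs, x ≤ b := by
    intro x hx
    obtain ⟨e, he, hxe⟩ := hbd x hx
    refine hxe.trans ?_
    rw [hsum, Multiset.mem_add, mem_splitCones] at he
    rcases he with ⟨e', he', h⟩ | he
    · exact h.trans (hbmax e' (by simp [he']))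
    · exact hle e (by simp [he])
  refine ⟨b :: bs, by simpa using ⟨hbd', hbs⟩, ?_, fun t => ?_, m + A'.card, fun t => ?_⟩
  · intro x hx
    refine ⟨b, by simp, ?_⟩
    rcases List.mem_cons.1 hx with rfl | hx
    · exact le_rfl
    · exact hbd' x hx
  · have h := sum_map_splitCones A' t
    have h2 := hval0 (t - 1)
    rw [hv0] at h2
    simp only [levelSum, List.map_cons, Multiset.map_cons, Multiset.sum_cons,
      Multiset.map_singleton, Multiset.sum_singleton] at h2 ⊢
    linarith
  · have h := sum_map_splitCones_succ A' t
    have h2 := hval1 (t - 1)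
    rw [hv1] at h2
    simp only [levelSum, List.map_cons, Multiset.map_cons, Multiset.sum_cons,
      Multiset.map_singleton, Multiset.sum_singleton] at h2 ⊢
    rw [Nat.cast_add m A'.card]
    linarith

/-! ### Uniqueness of Gotzmann partitions -/

theorem polyBinom_natCast (a : ℤ) (b : ℕ) :
    polyBinom a b = (Nat.factorial b : ℚ)⁻¹ •
      (descPochhammer ℚ b).comp (Polynomial.X + Polynomial.C (a : ℚ)) := by
  simp [polyBinom]

theorem eval_polyBinom (a : ℤ) (b : ℕ) (t : ℤ) :
    (polyBinom a b).eval (t : ℚ) = ((Ring.choose (t + a) b : ℤ) : ℚ) := by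
  have h := Ring.descPochhammer_eq_factorial_smul_choose (t + a) b
  have h2 : (descPochhammer ℚ b).eval ((t : ℚ) + (a : ℚ))
      = (((descPochhammer ℤ b).smeval (t + a) : ℤ) : ℚ) := by
    rw [← descPochhammer_map (Int.castRingHom ℚ), ← Polynomial.eval_eq_smeval, ← Int.cast_add]
    exact Polynomial.eval_intCast_map _ _ _
  have h3 : (Nat.factorial b : ℚ) ≠ 0 := by positivity
  rw [polyBinom_natCast]
  simp only [Polynomial.eval_smul, Polynomial.eval_comp, Polynomial.eval_add, Polynomial.eval_X,
    Polynomial.eval_C, smul_eq_mul]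
  rw [h2, h]
  simp
  field_simp

theorem natDegree_polyBinom_le (a : ℤ) (b : ℕ) : (polyBinom a b).natDegree ≤ b := by
  rw [polyBinom_natCast]
  refine (Polynomial.natDegree_smul_le _ _).trans ?_
  rw [Polynomial.natDegree_comp, descPochhammer_natDegree, Polynomial.natDegree_X_add_C, mul_one]

theorem coeff_polyBinom_pos (a : ℤ) (b : ℕ) : 0 < (polyBinom a b).coeff b := by
  rw [polyBinom_natCast, Polynomial.coeff_smul]
  have h : ((descPochhammer ℚ b).comp (Polynomial.X + Polynomial.C (a : ℚ))).Monic :=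
    (monic_descPochhammer ℚ b).comp_X_add_C _
  have h2 := h.coeff_natDegree
  rw [Polynomial.natDegree_comp, descPochhammer_natDegree, Polynomial.natDegree_X_add_C,
    mul_one] at h2
  rw [h2]
  simp only [smul_eq_mul, mul_one]
  positivity

/-- The Gotzmann expression of a list of dimensions, with degrees starting at `j` and all
dimensions raised by `c`. -/
noncomputable def gotzmannList (c : ℕ) : ℕ → List ℕ → Polynomial ℚ
  | _, [] => 0
  | j, x :: l => polyBinom (((x + c : ℕ) : ℤ) - j) ((x + c : ℕ) : ℤ) + gotzmannList c (j + 1) l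

theorem eval_gotzmannList (c j : ℕ) (l : List ℕ) (t : ℤ) :
    (gotzmannList c j l).eval (t : ℚ) = ((levelSum c (l.map fun x => {x}) (t - j) : ℤ) : ℚ) := by
  induction l generalizing j with
  | nil => simp [gotzmannList, levelSum]
  | cons x l ih =>
    rw [gotzmannList, Polynomial.eval_add, ih, eval_polyBinom]
    simp only [List.map_cons, levelSum, Multiset.map_singleton, Multiset.sum_singleton]
    rw [show t + (((x + c : ℕ) : ℤ) - j) = t - j + ((x + c : ℕ) : ℤ) by ring,
      show t - ((j + 1 : ℕ) : ℤ) = t - j - 1 by push_cast; ring, Int.cast_add]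

theorem gotzmannList_natDegree_le_and_coeff_nonneg (j d : ℕ) (l : List ℕ) (h : ∀ x ∈ l, x ≤ d) :
    (gotzmannList 0 j l).natDegree ≤ d ∧ 0 ≤ (gotzmannList 0 j l).coeff d := by
  induction l generalizing j with
  | nil => simp [gotzmannList]
  | cons x l ih =>
    obtain ⟨h1, h2⟩ := ih (j + 1) fun y hy => h y (by simp [hy])
    have hx := h x (by simp)
    rw [gotzmannList, Polynomial.coeff_add]
    refine ⟨Polynomial.natDegree_add_le_of_degree_le
      ((natDegree_polyBinom_le _ _).trans (by simpa using hx)) h1, add_nonneg ?_ h2⟩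
    rcases hx.lt_or_eq with hlt | rfl
    · exact (Polynomial.coeff_eq_zero_of_natDegree_lt
        ((natDegree_polyBinom_le _ _).trans_lt (by simpa using hlt))).ge
    · exact (coeff_polyBinom_pos _ _).le

theorem natDegree_gotzmannList_cons (j x : ℕ) (l : List ℕ) (h : (x :: l).Pairwise (· ≥ ·)) :
    (gotzmannList 0 j (x :: l)).natDegree = x ∧ gotzmannList 0 j (x :: l) ≠ 0 := by
  rw [List.pairwise_cons] at h
  have hpos : 0 < (gotzmannList 0 j (x :: l)).coeff x := by
    rw [gotzmannList, Polynomial.coeff_add]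
    exact add_pos_of_pos_of_nonneg (coeff_polyBinom_pos _ _)
      (gotzmannList_natDegree_le_and_coeff_nonneg (j + 1) x l h.1).2
  have hle := (gotzmannList_natDegree_le_and_coeff_nonneg j x (x :: l)
    (by simpa using h.1)).1
  refine ⟨le_antisymm hle (Polynomial.le_natDegree_of_ne_zero hpos.ne'), ?_⟩
  intro h0
  simp [h0] at hpos

theorem gotzmannList_injective (j : ℕ) (l l' : List ℕ) (hl : l.Pairwise (· ≥ ·))
    (hl' : l'.Pairwise (· ≥ ·)) (h : gotzmannList 0 j l = gotzmannList 0 j l') : l = l' := by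
  induction l generalizing j l' with
  | nil =>
    match l', hl' with
    | [], _ => rfl
    | x :: l', hl' => exact absurd h.symm (natDegree_gotzmannList_cons j x l' hl').2
  | cons x l ih =>
    match l', hl' with
    | [], _ => exact absurd h (natDegree_gotzmannList_cons j x l hl).2
    | y :: l', hl' =>
      have hxy : x = y := by
        rw [← (natDegree_gotzmannList_cons j x l hl).1, ← (natDegree_gotzmannList_cons j y l' hl').1, h]
      subst hxy
      rw [ih (j + 1) l' (List.pairwise_cons.1 hl).2 (List.pairwise_cons.1 hl').2
        (add_left_cancel h)]

theorem gotzmannList_ofFn (c r : ℕ) (b : Fin r → ℕ) (i : ℕ) :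
    gotzmannList c i (List.ofFn b) =
      ∑ j : Fin r, polyBinom (((b j + c : ℕ) : ℤ) - ((i + j : ℕ) : ℤ)) ((b j + c : ℕ) : ℤ) := by
  induction r generalizing i with
  | zero => simp [gotzmannList]
  | succ r ih =>
    rw [List.ofFn_succ, gotzmannList, ih, Fin.sum_univ_succ]
    congr 1
    refine Finset.sum_congr rfl fun j _ => ?_
    rw [Fin.val_succ, show i + 1 + (j : ℕ) = i + (j + 1) by ring]

theorem Polynomial.eq_of_eventually_eval_natCast_eq (p q : Polynomial ℚ) (N : ℕ)
    (h : ∀ i : ℕ, N ≤ i → p.eval (i : ℚ) = q.eval (i : ℚ)) : p = q := by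
  refine Polynomial.eq_of_infinite_eval_eq p q (Set.Infinite.mono (s := (↑) '' Set.Ici N) ?_ ?_)
  · rintro _ ⟨i, hi, rfl⟩
    exact h i hi
  · exact (Set.Ici_infinite N).image (Nat.cast_injective.injOn)

/-! ### Cone decompositions of the standard monomials of a saturated Borel ideal -/

/-- Exponent vectors closed under replacing a variable by one of smaller index. -/
def IsBorelSet {N : ℕ} (U : Set (Fin N →₀ ℕ)) : Prop :=
  ∀ u ∈ U, ∀ j, u j ≠ 0 → ∀ i < j, u - Finsupp.single j 1 + Finsupp.single i 1 ∈ U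

/-- The pairs `(w, s)` such that `w` only involves variables of index less than `s` and `s` is
the least index for which no `w * x_s ^ D` lies in `U`. -/
def coneApexes {N : ℕ} (U : Set (Fin N →₀ ℕ)) : Set ((Fin N →₀ ℕ) × Fin N) :=
  {p | (∀ i, p.2 ≤ i → p.1 i = 0) ∧ (∀ D, p.1 + Finsupp.single p.2 D ∉ U) ∧
    ∀ s < p.2, ∃ D, p.1 + Finsupp.single s D ∈ U}

theorem IsBorelSet.add_single_mem {N : ℕ} {U : Set (Fin N →₀ ℕ)} (hB : IsBorelSet U)
    {w : Fin N →₀ ℕ} {s j : Fin N} (hsj : s ≤ j) {a : ℕ} (h : w + Finsupp.single j a ∈ U) :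
    w + Finsupp.single s a ∈ U := by
  rcases hsj.eq_or_lt with rfl | hlt
  · exact h
  induction a generalizing w with
  | zero => simpa using h
  | succ a ih =>
    have h1 := hB _ h j (by simp) s hlt
    have h2 : w + Finsupp.single j (a + 1) - Finsupp.single j 1 + Finsupp.single s 1
        = (w + Finsupp.single s 1) + Finsupp.single j a := by
      rw [Finsupp.single_add, ← add_assoc, add_tsub_cancel_right]
      abel
    rw [h2] at h1
    have h3 := ih h1
    rwa [add_assoc, ← Finsupp.single_add, add_comm 1 a] at h3

theorem IsBorelSet.add_single_degree_mem {N : ℕ} {U : Set (Fin N →₀ ℕ)} (hB : IsBorelSet U)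
    {s : Fin N} (v : Fin N →₀ ℕ) : ∀ {w : Fin N →₀ ℕ}, (∀ i, v i ≠ 0 → s ≤ i) → w + v ∈ U →
      w + Finsupp.single s v.degree ∈ U := by
  classical
  induction v using Finsupp.induction with
  | zero => intro w _ h; simpa using h
  | single_add j a v hj ha ih =>
    intro w hv h
    have hsj : s ≤ j := hv j (by
      simp only [Finsupp.add_apply, Finsupp.single_eq_same]
      omega)
    rw [← add_assoc] at h
    have h1 := ih (fun i hi => hv i (by simp only [Finsupp.add_apply]; omega)) h
    rw [add_right_comm] at h1
    have h2 := hB.add_single_mem hsj h1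
    rwa [add_assoc, ← Finsupp.single_add, add_comm v.degree, ← Finsupp.degree_single j a,
      ← map_add] at h2

theorem IsUpperSet.add_single_mem_of_le {N : ℕ} {U : Set (Fin N →₀ ℕ)} (hU : IsUpperSet U)
    {w w' : Fin N →₀ ℕ} (hw : w ≤ w') {i : Fin N} {D : ℕ} (h : w + Finsupp.single i D ∈ U) :
    w' + Finsupp.single i D ∈ U :=
  hU (by gcongr) h

theorem coneApexes_finite {N : ℕ} {U : Set (Fin N →₀ ℕ)} (hU : IsUpperSet U) :
    (coneApexes U).Finite := by
  by_contra hinf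
  have : ∃ s, {w | (w, s) ∈ coneApexes U}.Infinite := by
    by_contra! hfin
    apply hinf
    have h := Set.finite_iUnion fun s => (hfin s).image fun w => (w, s)
    refine h.subset fun p hp => ?_
    simp only [Set.mem_iUnion]
    exact ⟨p.2, p.1, hp, rfl⟩
  obtain ⟨s, hs⟩ := this
  have hsub := (Set.isPWO_iff_exists_monotone_subseq.1
    (Set.isPWO_of_wellQuasiOrderedLE {w | (w, s) ∈ coneApexes U}))
    (fun i => hs.natEmbedding _ i) (fun i => (hs.natEmbedding _ i).2)
  obtain ⟨g, hg⟩ := hsub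
  set f : ℕ → Fin N →₀ ℕ := fun i => hs.natEmbedding _ (g i) with hf
  have hmem : ∀ i, (f i, s) ∈ coneApexes U := fun i => (hs.natEmbedding _ (g i)).2
  have hinj : Function.Injective f :=
    Subtype.val_injective.comp ((hs.natEmbedding _).injective.comp g.injective)
  have hmono : Monotone f := hg
  have hbd : ∀ i, ∃ D, ∀ k, f k i ≤ D := by
    intro i
    rcases le_or_gt s i with hsi | his
    · exact ⟨0, fun k => ((hmem k).1 i hsi).le⟩
    · obtain ⟨D, hD⟩ := (hmem 0).2.2 i his
      refine ⟨f 0 i + D, fun k => ?_⟩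
      by_contra! hk
      refine (hmem k).2.1 0 (hU ?_ hD)
      simp only [Finsupp.single_zero, add_zero]
      intro l
      have := hmono (Nat.zero_le k) l
      by_cases hl : l = i
      · subst hl
        simpa using hk.le
      · simpa [Finsupp.single_apply, Ne.symm hl] using this
  choose D hD using hbd
  have : (Set.Iic (Finsupp.equivFunOnFinite.symm D)).Finite := Set.finite_Iic _
  exact Set.infinite_of_injective_forall_mem hinj
    (fun k => Set.mem_Iic.2 (show f k ≤ Finsupp.equivFunOnFinite.symm D from fun i => hD i k)) this

/-- Removing the last variable of the apex of a cone leaves the apex of a cone of at least the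
same dimension. -/
theorem exists_mem_coneApexes_degree_eq {N : ℕ} {U : Set (Fin N →₀ ℕ)} (hU : IsUpperSet U)
    (hB : IsBorelSet U) {w : Fin N →₀ ℕ} {s : Fin N} (h : (w, s) ∈ coneApexes U) {d : ℕ}
    (hd : w.degree = d + 1) : ∃ w' s', (w', s') ∈ coneApexes U ∧ w'.degree = d ∧ s' ≤ s := by
  classical
  obtain ⟨h1, h2, h3⟩ := h
  have hne : w.support.Nonempty := by
    rw [Finsupp.support_nonempty_iff]
    rintro rfl
    simp at hd
  set j := w.support.max' hne with hj
  have hwj : w j ≠ 0 := Finsupp.mem_support_iff.1 (w.support.max'_mem hne)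
  have hmax : ∀ i, w i ≠ 0 → i ≤ j := fun i hi =>
    w.support.le_max' i (Finsupp.mem_support_iff.2 hi)
  have hjs : j < s := by
    by_contra! hle
    exact hwj (h1 j hle)
  have hww : w - Finsupp.single j 1 + Finsupp.single j 1 = w :=
    tsub_add_cancel_of_le (by simpa using Nat.one_le_iff_ne_zero.2 hwj)
  set w' := w - Finsupp.single j 1 with hw'
  have hle : w' ≤ w := tsub_le_self
  have hex : ∃ s', ∀ D, w' + Finsupp.single s' D ∉ U :=
    ⟨s, fun D hD => h2 D (hU.add_single_mem_of_le hle hD)⟩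
  obtain ⟨s', hs', hmin⟩ := WellFounded.has_min (wellFounded_lt (α := Fin N))
    {s' | ∀ D, w' + Finsupp.single s' D ∉ U} hex
  have hs's : s' ≤ s := not_lt.1 (hmin s fun D hD => h2 D (hU.add_single_mem_of_le hle hD))
  have hjs' : j < s' := by
    by_contra! hle'
    obtain ⟨D, hD⟩ := h3 s' (hle'.trans_lt hjs)
    rw [← hww, add_right_comm] at hD
    have := hB.add_single_mem hle' hD
    rw [add_assoc, ← Finsupp.single_add] at this
    exact hs' _ this
  refine ⟨w', s', ⟨fun i hi => ?_, hs', fun s'' hs'' => ?_⟩, ?_, hs's⟩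
  · have : w i = 0 := by
      by_contra hi0
      exact absurd (hmax i hi0) (not_le.2 (hjs'.trans_le hi))
    exact Nat.le_zero.1 ((hle i).trans this.le)
  · by_contra! hc
    exact hmin s'' hc hs''
  · have := congrArg Finsupp.degree hww
    rw [map_add, Finsupp.degree_single, hd] at this
    omega

/-- Every standard monomial of a saturated Borel ideal lies in exactly one cone. -/
theorem notMem_iff_exists_mem_coneApexes {n : ℕ} {U : Set (Fin (n + 1) →₀ ℕ)} (hU : IsUpperSet U)
    (hB : IsBorelSet U) (hS : ∀ u, u + Finsupp.single (Fin.last n) 1 ∈ U → u ∈ U)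
    (u : Fin (n + 1) →₀ ℕ) :
    u ∉ U ↔ ∃ p ∈ coneApexes U, ∃ v : Fin (n + 1) →₀ ℕ, (∀ i, v i ≠ 0 → p.2 ≤ i) ∧
      u = p.1 + v := by
  classical
  constructor
  · intro hu
    have hlast : ∀ D, u + Finsupp.single (Fin.last n) D ∉ U := by
      intro D
      induction D with
      | zero => simpa using hu
      | succ D ih =>
        intro h
        rw [Finsupp.single_add, ← add_assoc] at h
        exact ih (hS _ h)
    obtain ⟨s, hs, hmin⟩ := WellFounded.has_min (wellFounded_lt (α := Fin (n + 1)))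
      {s | ∀ D, u + Finsupp.single s D ∉ U} ⟨_, hlast⟩
    have hsum : u.filter (· < s) + u.filter (fun i => ¬ i < s) = u :=
      Finsupp.filter_add_filter_not _ _
    have hsupp : ∀ i, u.filter (fun i => ¬ i < s) i ≠ 0 → s ≤ i := by
      intro i hi
      by_contra! hlt
      exact hi (Finsupp.filter_apply_neg _ _ (by simpa using hlt))
    refine ⟨(u.filter (· < s), s), ⟨fun i hi => ?_, fun D hD => ?_, fun s' hs' => ?_⟩,
      u.filter (fun i => ¬ i < s), hsupp, hsum.symm⟩
    · exact Finsupp.filter_apply_neg _ _ (not_lt.2 hi)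
    · refine hs D (hU.add_single_mem_of_le ?_ hD)
      exact le_of_le_of_eq le_self_add hsum
    · have : ∃ D, u + Finsupp.single s' D ∈ U := by
        by_contra! hc
        exact hmin s' hc hs'
      obtain ⟨D, hD⟩ := this
      rw [← hsum, add_right_comm] at hD
      have := hB.add_single_degree_mem _ (fun i hi => hs'.le.trans (hsupp i hi)) hD
      rw [add_assoc, ← Finsupp.single_add] at this
      exact ⟨_, this⟩
  · rintro ⟨⟨w, s⟩, ⟨-, h2, -⟩, v, hv, rfl⟩ hu
    exact h2 _ (hB.add_single_degree_mem v hv hu)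

theorem coneApexes_eq_of_add_eq {N : ℕ} {U : Set (Fin N →₀ ℕ)} (hU : IsUpperSet U)
    (hB : IsBorelSet U) {p q : (Fin N →₀ ℕ) × Fin N} (hp : p ∈ coneApexes U)
    (hq : q ∈ coneApexes U) {v v' : Fin N →₀ ℕ} (hv : ∀ i, v i ≠ 0 → p.2 ≤ i)
    (hv' : ∀ i, v' i ≠ 0 → q.2 ≤ i) (h : p.1 + v = q.1 + v') : p = q := by
  have key : ∀ {p q : (Fin N →₀ ℕ) × Fin N}, p ∈ coneApexes U → q ∈ coneApexes U →
      ∀ {v v' : Fin N →₀ ℕ}, (∀ i, v i ≠ 0 → p.2 ≤ i) → (∀ i, v' i ≠ 0 → q.2 ≤ i) →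
      p.1 + v = q.1 + v' → ¬ p.2 < q.2 := by
    intro p q hp hq v v' hv hv' h hlt
    obtain ⟨D, hD⟩ := hq.2.2 _ hlt
    have h1 : p.1 + Finsupp.single p.2 D + v ∈ U := by
      rw [add_right_comm, h]
      exact hU.add_single_mem_of_le le_self_add hD
    have h2 := hB.add_single_degree_mem v hv h1
    rw [add_assoc, ← Finsupp.single_add] at h2
    exact hp.2.1 _ h2
  have hs : p.2 = q.2 := le_antisymm (not_lt.1 (key hq hp hv' hv h.symm))
    (not_lt.1 (key hp hq hv hv' h))
  refine Prod.ext ?_ hs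
  ext i
  rcases le_or_gt p.2 i with hi | hi
  · rw [hp.1 i hi, hq.1 i (hs ▸ hi)]
  · have hvi : v i = 0 := by
      by_contra h0
      exact absurd (hv i h0) (not_le.2 hi)
    have hvi' : v' i = 0 := by
      by_contra h0
      exact absurd (hv' i h0) (not_le.2 (hs ▸ hi))
    have := DFunLike.congr_fun h i
    simpa [hvi, hvi'] using this

/-! ### Counting standard monomials -/

open Classical in
/-- The exponent vectors of degree `t` outside `U`. -/
noncomputable def stdMonomials {N : ℕ} (U : Set (Fin N →₀ ℕ)) (t : ℕ) : Finset (Fin N →₀ ℕ) :=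
  (Finset.finsuppAntidiag Finset.univ t).filter (· ∉ U)

theorem mem_stdMonomials {N : ℕ} {U : Set (Fin N →₀ ℕ)} {t : ℕ} {u : Fin N →₀ ℕ} :
    u ∈ stdMonomials U t ↔ u.degree = t ∧ u ∉ U := by
  simp [stdMonomials, Finsupp.degree_eq_sum]

open Classical in
/-- The exponent vectors of degree `t` of the form `p.1 + v` with `v` supported in indices at
least `p.2`. -/
noncomputable def coneMonomials {N : ℕ} (p : (Fin N →₀ ℕ) × Fin N) (t : ℕ) :
    Finset (Fin N →₀ ℕ) :=
  if p.1.degree ≤ t then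
    (Finset.finsuppAntidiag (Finset.Ici p.2) (t - p.1.degree)).map (addLeftEmbedding p.1)
  else ∅

theorem mem_coneMonomials {N : ℕ} {p : (Fin N →₀ ℕ) × Fin N} {t : ℕ} {u : Fin N →₀ ℕ} :
    u ∈ coneMonomials p t ↔ u.degree = t ∧ ∃ v : Fin N →₀ ℕ, (∀ i, v i ≠ 0 → p.2 ≤ i) ∧
      u = p.1 + v := by
  have hv : ∀ v : Fin N →₀ ℕ, v.support ⊆ Finset.Ici p.2 ↔ ∀ i, v i ≠ 0 → p.2 ≤ i := by
    intro v
    simp [Finset.subset_iff]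
  have hdeg : ∀ v : Fin N →₀ ℕ, (v.sum fun _ x => x) = v.degree := fun _ => rfl
  rw [coneMonomials]
  split_ifs with h
  · simp only [Finset.mem_map, Finset.mem_finsuppAntidiag', hv, hdeg, addLeftEmbedding_apply]
    constructor
    · rintro ⟨v, ⟨hd, hs⟩, rfl⟩
      exact ⟨by rw [map_add]; omega, v, hs, rfl⟩
    · rintro ⟨hd, v, hs, rfl⟩
      rw [map_add] at hd
      exact ⟨v, ⟨by omega, hs⟩, rfl⟩
  · simp only [Finset.notMem_empty, false_iff]
    rintro ⟨hd, v, hs, rfl⟩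
    rw [map_add] at hd
    omega

theorem card_coneMonomials {n : ℕ} (p : (Fin (n + 1) →₀ ℕ) × Fin (n + 1)) (t : ℕ) :
    (coneMonomials p t).card = if p.1.degree ≤ t then
      (t - p.1.degree + (n - p.2)).choose (n - p.2) else 0 := by
  rw [coneMonomials]
  split_ifs with h
  · rw [Finset.card_map, Finset.card_finsuppAntidiag_nat_eq_choose, Fin.card_Ici]
    have := p.2.is_lt
    rw [← Nat.choose_symm_add]
    congr 1
    omega
  · simp

theorem card_stdMonomials {n : ℕ} {U : Set (Fin (n + 1) →₀ ℕ)} (hU : IsUpperSet U)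
    (hB : IsBorelSet U) (hS : ∀ u, u + Finsupp.single (Fin.last n) 1 ∈ U → u ∈ U) (t : ℕ) :
    (stdMonomials U t).card = ∑ p ∈ (coneApexes_finite hU).toFinset,
      if p.1.degree ≤ t then (t - p.1.degree + (n - p.2)).choose (n - p.2) else 0 := by
  classical
  have h : stdMonomials U t = (coneApexes_finite hU).toFinset.biUnion (coneMonomials · t) := by
    ext u
    simp only [mem_stdMonomials, Finset.mem_biUnion, Set.Finite.mem_toFinset, mem_coneMonomials,
      notMem_iff_exists_mem_coneApexes hU hB hS u]
    tauto
  rw [h, Finset.card_biUnion]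
  · exact Finset.sum_congr rfl fun p _ => card_coneMonomials p t
  · intro p hp q hq hpq
    rw [Function.onFun, Finset.disjoint_left]
    intro u hup huq
    obtain ⟨-, v, hv, rfl⟩ := mem_coneMonomials.1 hup
    obtain ⟨-, v', hv', h⟩ := mem_coneMonomials.1 huq
    exact hpq (coneApexes_eq_of_add_eq hU hB ((coneApexes_finite hU).mem_toFinset.1 hp)
      ((coneApexes_finite hU).mem_toFinset.1 hq) hv hv' h)

theorem sum_range_ite_choose (d e t : ℕ) :
    (∑ t' ∈ Finset.range (t + 1), if d ≤ t' then (t' - d + e).choose e else 0)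
      = if d ≤ t then (t - d + (e + 1)).choose (e + 1) else 0 := by
  induction t with
  | zero =>
    rcases Nat.eq_zero_or_pos d with rfl | hd
    · simp
    · simp [hd.ne']
  | succ t ih =>
    rw [Finset.sum_range_succ, ih]
    rcases lt_trichotomy d (t + 1) with h | h | h
    · rw [if_pos (by omega), if_pos (by omega), if_pos (by omega),
        show t + 1 - d = t - d + 1 by omega,
        show t - d + 1 + (e + 1) = (t - d + 1 + e) + 1 by omega, Nat.choose_succ_succ,
        show t - d + (e + 1) = t - d + 1 + e by omega, add_comm]
    · subst h
      simp
    · rw [if_neg (by omega), if_neg (by omega), if_neg (by omega)]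

/-- The standard monomials of an extended ideal are counted by the standard monomials of the
original ideal of smaller or equal degree. -/
theorem card_stdMonomials_castSucc {N : ℕ} (U : Set (Fin N →₀ ℕ)) (U' : Set (Fin (N + 1) →₀ ℕ))
    (h : ∀ u, u ∈ U' ↔ u.comapDomain Fin.castSucc (Fin.castSucc_injective N).injOn ∈ U) (t : ℕ) :
    (stdMonomials U' t).card = ∑ d ∈ Finset.range (t + 1), (stdMonomials U d).card := by
  classical
  rw [← Finset.card_biUnion]
  · have hdeg : ∀ u : Fin (N + 1) →₀ ℕ, u.degree =
        (u.comapDomain Fin.castSucc (Fin.castSucc_injective N).injOn).degree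
          + u (Fin.last N) := by
      intro u
      simp [Finsupp.degree_eq_sum, Fin.sum_univ_castSucc]
    refine Finset.card_bij
      (fun u _ => u.comapDomain Fin.castSucc (Fin.castSucc_injective N).injOn) ?_ ?_ ?_
    · intro u hu
      rw [mem_stdMonomials, h, hdeg] at hu
      simp only [Finset.mem_biUnion, mem_stdMonomials, Finset.mem_range]
      exact ⟨_, by omega, rfl, hu.2⟩
    · intro u hu v hv huv
      rw [mem_stdMonomials, hdeg] at hu hv
      have hl : u (Fin.last N) = v (Fin.last N) := by
        rw [huv] at hu
        omega
      ext i
      induction i using Fin.lastCases with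
      | last => exact hl
      | cast i => simpa using DFunLike.congr_fun huv i
    · intro v hv
      simp only [Finset.mem_biUnion, mem_stdMonomials, Finset.mem_range] at hv
      obtain ⟨d, hd, rfl, hvU⟩ := hv
      set u : Fin (N + 1) →₀ ℕ := Finsupp.equivFunOnFinite.symm
        (Fin.snoc (α := fun _ => ℕ) v (t - v.degree)) with hu
      have hc : u.comapDomain Fin.castSucc (Fin.castSucc_injective N).injOn = v := by
        ext i
        simp [hu]
      refine ⟨u, ?_, hc⟩
      rw [mem_stdMonomials, h, hdeg, hc]
      refine ⟨?_, hvU⟩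
      have : u (Fin.last N) = t - v.degree := by simp [hu]
      omega
  · intro d _ d' _ hdd
    rw [Function.onFun, Finset.disjoint_left]
    intro u hu hu'
    rw [mem_stdMonomials] at hu hu'
    exact hdd (hu.1.symm.trans hu'.1)

theorem levelSum_map_range' (c : ℕ) (F : ℕ → Multiset ℕ) (D : ℕ) (j : ℕ) (t : ℤ) :
    levelSum c ((List.range' j D).map F) t = ∑ d ∈ Finset.range D,
      ((F (j + d)).map fun e => Ring.choose (t - d + ((e + c : ℕ) : ℤ)) (e + c)).sum := by
  induction D generalizing j t with
  | zero => simp [levelSum]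
  | succ D ih =>
    rw [List.range'_succ, List.map_cons, levelSum, ih, Finset.sum_range_succ', add_comm]
    congr 1
    · refine Finset.sum_congr rfl fun d _ => ?_
      rw [show j + 1 + d = j + (d + 1) by ring,
        show t - 1 - (d : ℤ) = t - ((d + 1 : ℕ) : ℤ) by push_cast; ring]
    · simp

/-- The numbers of standard monomials of a saturated Borel ideal, and of its extension to one more
variable, are given by one collection of cones. -/
theorem exists_levelSum_eq_card_stdMonomials {n : ℕ} {U : Set (Fin (n + 1) →₀ ℕ)}
    (hU : IsUpperSet U) (hB : IsBorelSet U)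
    (hS : ∀ u, u + Finsupp.single (Fin.last n) 1 ∈ U → u ∈ U) :
    ∃ L : List (Multiset ℕ), L.Pairwise IsDominatedBy ∧ ∃ N : ℕ, ∀ t : ℕ, N ≤ t →
      ((stdMonomials U t).card : ℤ) = levelSum 0 L t ∧
      ((∑ d ∈ Finset.range (t + 1), (stdMonomials U d).card : ℕ) : ℤ) = levelSum 1 L t := by
  classical
  set W := (coneApexes_finite hU).toFinset with hW
  set D := W.sup (fun p => p.1.degree) with hD
  set F : ℕ → Multiset ℕ := fun d =>
    (W.filter fun p => p.1.degree = d).val.map fun p => n - (p.2 : ℕ) with hF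
  have hdegD : ∀ p ∈ W, p.1.degree ≤ D := fun p hp =>
    Finset.le_sup (f := fun p : (Fin (n + 1) →₀ ℕ) × Fin (n + 1) => p.1.degree) hp
  have hval : ∀ (c t : ℕ), D ≤ t → levelSum c ((List.range' 0 (D + 1)).map F) t =
      ((∑ p ∈ W, if p.1.degree ≤ t then
        (t - p.1.degree + (n - p.2 + c)).choose (n - p.2 + c) else 0 : ℕ) : ℤ) := by
    intro c t ht
    rw [levelSum_map_range', ← Finset.sum_fiberwise_of_maps_to (s := W)
      (t := Finset.range (D + 1)) (g := fun p => p.1.degree)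
      (fun p hp => Finset.mem_range.2 (Nat.lt_succ_of_le (hdegD p hp))), Nat.cast_sum]
    refine Finset.sum_congr rfl fun d hd => ?_
    rw [hF, Multiset.map_map, Nat.cast_sum, zero_add]
    refine Finset.sum_congr rfl fun p hp => ?_
    obtain ⟨hpW, rfl⟩ := Finset.mem_filter.1 hp
    have hle := (hdegD p hpW).trans ht
    rw [if_pos hle, ← Ring.choose_natCast]
    simp only [Function.comp_apply]
    push_cast [Nat.cast_sub hle]
    rfl
  refine ⟨(List.range' 0 (D + 1)).map F, ?_, D, fun t ht => ⟨?_, ?_⟩⟩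
  · rw [List.pairwise_map]
    have hstep : ∀ k d, IsDominatedBy (F d) (F (d + k)) := by
      intro k
      induction k with
      | zero => exact fun d e he => ⟨e, he, le_rfl⟩
      | succ k ih =>
        intro d e he
        simp only [hF, Multiset.mem_map, Finset.mem_val, Finset.mem_filter] at he
        obtain ⟨p, ⟨hp, hpd⟩, rfl⟩ := he
        obtain ⟨w, s, hws, hd, hs⟩ := exists_mem_coneApexes_degree_eq hU hB (w := p.1) (s := p.2)
          ((coneApexes_finite hU).mem_toFinset.1 hp) (d := d + k) hpd
        obtain ⟨e', he', hle⟩ := ih d (n - (s : ℕ)) (by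
          simp only [hF, Multiset.mem_map, Finset.mem_val, Finset.mem_filter]
          exact ⟨(w, s), ⟨(coneApexes_finite hU).mem_toFinset.2 hws, hd⟩, rfl⟩)
        exact ⟨e', he', (Nat.sub_le_sub_left hs n).trans hle⟩
    refine (List.pairwise_lt_range' (s := 0) (n := D + 1)).imp fun {a b} hab => ?_
    obtain ⟨k, rfl⟩ := Nat.exists_eq_add_of_lt hab
    exact hstep (k + 1) a
  · rw [hval 0 t ht, card_stdMonomials hU hB hS]
    rfl
  · rw [hval 1 t ht]
    simp only [card_stdMonomials hU hB hS]
    rw [Finset.sum_comm]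
    simp only [sum_range_ite_choose]
    rfl

/-! ### Hilbert functions of monomial ideals -/

/-- The exponent vectors of the monomials in the ideal generated by the monomials with exponents
in `S`. -/
def upperSetOf {N : ℕ} (S : Set (Fin N →₀ ℕ)) : Set (Fin N →₀ ℕ) :=
  {u | ∃ s ∈ S, s ≤ u}

theorem isUpperSet_upperSetOf {N : ℕ} (S : Set (Fin N →₀ ℕ)) : IsUpperSet (upperSetOf S) :=
  fun _ _ huv ⟨s, hs, hsu⟩ => ⟨s, hs, hsu.trans huv⟩

theorem mem_span_monomial_iff {k : Type*} [Field k] {N : ℕ} (S : Set (Fin N →₀ ℕ))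
    (f : MvPolynomial (Fin N) k) :
    f ∈ Ideal.span ((fun u => MvPolynomial.monomial u (1 : k)) '' S) ↔
      ∀ u, f.coeff u ≠ 0 → u ∈ upperSetOf S := by
  rw [MvPolynomial.mem_ideal_span_monomial_image]
  simp [upperSetOf]

theorem monomial_mem_span_iff {k : Type*} [Field k] {N : ℕ} (S : Set (Fin N →₀ ℕ))
    (u : Fin N →₀ ℕ) :
    MvPolynomial.monomial u (1 : k) ∈
      Ideal.span ((fun u => MvPolynomial.monomial u (1 : k)) '' S) ↔ u ∈ upperSetOf S := by
  classical
  rw [mem_span_monomial_iff]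
  simp [MvPolynomial.coeff_monomial]

theorem hilbFn_span_monomial {k : Type*} [Field k] {N : ℕ} (S : Set (Fin N →₀ ℕ)) (t : ℕ) :
    hilbFn (Ideal.span ((fun u => MvPolynomial.monomial u (1 : k)) '' S)) t
      = (stdMonomials (upperSetOf S) t).card := by
  classical
  let φ : MvPolynomial.homogeneousSubmodule (Fin N) k t →ₗ[k]
      (stdMonomials (upperSetOf S) t → k) :=
    (LinearMap.pi fun u => MvPolynomial.lcoeff k u.1).comp (Submodule.subtype _)
  have hφ : ∀ f u, φ f u = f.1.coeff u.1 := fun f u => rfl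
  have hker : LinearMap.ker φ = Submodule.comap
      (MvPolynomial.homogeneousSubmodule (Fin N) k t).subtype (Submodule.restrictScalars k
        (Ideal.span ((fun u => MvPolynomial.monomial u (1 : k)) '' S))) := by
    ext f
    rw [LinearMap.mem_ker, Submodule.mem_comap, Submodule.restrictScalars_mem,
      Submodule.subtype_apply, mem_span_monomial_iff]
    constructor
    · intro h u hu
      by_contra hmem
      have hd : u.degree = t := by
        have := (MvPolynomial.mem_homogeneousSubmodule _ _).1 f.2 hu
        rwa [Finsupp.degree_eq_weight_one]
      exact hu (congrFun h ⟨u, mem_stdMonomials.2 ⟨hd, hmem⟩⟩)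
    · intro h
      ext u
      by_contra hu
      exact (mem_stdMonomials.1 u.2).2 (h u.1 hu)
  have hsurj : Function.Surjective φ := by
    intro g
    refine ⟨⟨∑ u : stdMonomials (upperSetOf S) t, MvPolynomial.monomial u.1 (g u),
      Submodule.sum_mem _ fun u _ => ?_⟩, ?_⟩
    · exact MvPolynomial.isHomogeneous_monomial _ (mem_stdMonomials.1 u.2).1
    · ext v
      rw [hφ]
      simp [MvPolynomial.coeff_sum, MvPolynomial.coeff_monomial]
  rw [hilbFn, ← hker, (φ.quotKerEquivOfSurjective hsurj).finrank_eq]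
  simp

theorem map_rename_span_monomial {k : Type*} [Field k] {N M : ℕ} (f : Fin N → Fin M)
    (S : Set (Fin N →₀ ℕ)) :
    Ideal.map (MvPolynomial.rename f)
      (Ideal.span ((fun u => MvPolynomial.monomial u (1 : k)) '' S))
      = Ideal.span ((fun u => MvPolynomial.monomial u (1 : k)) '' (Finsupp.mapDomain f '' S)) := by
  rw [Ideal.map_span, Set.image_image, Set.image_image]
  simp [MvPolynomial.rename_monomial]

theorem mem_upperSetOf_mapDomain_castSucc {N : ℕ} (S : Set (Fin N →₀ ℕ)) (u : Fin (N + 1) →₀ ℕ) :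
    u ∈ upperSetOf (Finsupp.mapDomain Fin.castSucc '' S) ↔
      u.comapDomain Fin.castSucc (Fin.castSucc_injective N).injOn ∈ upperSetOf S := by
  simp only [upperSetOf, Set.mem_ofPred_eq, Set.exists_mem_image]
  refine exists_congr fun s => and_congr_right fun _ => ⟨fun h i => ?_, fun h i => ?_⟩
  · have := h i.castSucc
    rwa [Finsupp.mapDomain_apply (Fin.castSucc_injective N)] at this
  · induction i using Fin.lastCases with
    | last =>
      rw [Finsupp.mapDomain_of_notMem_range _ _ (by
        rintro ⟨i, hi⟩
        exact (Fin.castSucc_lt_last i).ne hi)]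
      exact Nat.zero_le _
    | cast i =>
      rw [Finsupp.mapDomain_apply (Fin.castSucc_injective N)]
      exact h i

theorem mem_upperSetOf_of_add_single_last_mem {k : Type*} [Field k] {n : ℕ}
    {S : Set (Fin (n + 1) →₀ ℕ)} (hB : IsBorelSet (upperSetOf S))
    (hsat : IsSaturatedIdeal (Ideal.span ((fun u => MvPolynomial.monomial u (1 : k)) '' S)))
    (u : Fin (n + 1) →₀ ℕ) (hu : u + Finsupp.single (Fin.last n) 1 ∈ upperSetOf S) :
    u ∈ upperSetOf S := by
  rw [← monomial_mem_span_iff (k := k)]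
  refine hsat _ ⟨1, le_rfl, fun g hg => ?_⟩
  rw [pow_one] at hg
  induction hg using Submodule.span_induction with
  | mem g hg =>
    obtain ⟨i, rfl⟩ := hg
    rw [MvPolynomial.X, MvPolynomial.monomial_mul, one_mul, monomial_mem_span_iff]
    exact hB.add_single_mem (Fin.le_last i) hu
  | zero => simp
  | add x y _ _ hx hy => rw [mul_add]; exact Ideal.add_mem _ hx hy
  | smul a x _ hx => rw [smul_eq_mul, mul_left_comm]; exact Ideal.mul_mem_left _ _ hx

/-- If `I ⊆ k[x_0,…,x_n]` is a saturated Borel monomial ideal whose Hilbert polynomial has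
Gotzmann partition `(b_1,…,b_r)`, then for some `m ∈ ℕ` the Hilbert polynomial of
`k[x_0,…,x_{n+1}]/(I·k[x_0,…,x_{n+1}])` is `m + Σ_{j=1}^r C(t + (b_j+1) − (j−1), b_j+1)`. -/
theorem statement_13 (k : Type*) [Field k] (n : ℕ)
    (I : Ideal (MvPolynomial (Fin (n + 1)) k))
    (hmon : IsMonomialIdeal I) (hborel : IsBorel I) (hsat : IsSaturatedIdeal I)
    (r : ℕ) (b : Fin r → ℤ) (hb : Antitone b) (hbnn : ∀ j, 0 ≤ b j)
    (hq : ∃ N : ℕ, ∀ i : ℕ, N ≤ i → (hilbFn I i : ℚ) = (gotzmannSum r b).eval (i : ℚ)) :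
    ∃ m : ℕ, ∃ N : ℕ, ∀ i : ℕ, N ≤ i →
      (hilbFn (Ideal.map (MvPolynomial.rename (Fin.castSucc : Fin (n + 1) → Fin (n + 2))) I)
          i : ℚ)
        = (Polynomial.C (m : ℚ) +
            ∑ j : Fin r, polyBinom (b j + 1 - ((j : ℕ) : ℤ)) (b j + 1)).eval (i : ℚ) := by
  obtain ⟨S, rfl⟩ := hmon
  have hB : IsBorelSet (upperSetOf S) := fun u hu j hj i hij =>
    (monomial_mem_span_iff (k := k) S _).1
      (hborel u ((monomial_mem_span_iff S u).2 hu) j hj i hij)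
  obtain ⟨L, hL, N, hN⟩ := exists_levelSum_eq_card_stdMonomials (isUpperSet_upperSetOf S) hB
    (mem_upperSetOf_of_add_single_last_mem hB hsat)
  obtain ⟨bs, hbs, -, hv0, m, hv1⟩ := exists_list_levelSum_eq L hL
  obtain ⟨N', hN'⟩ := hq
  lift b to Fin r → ℕ using hbnn
  have hg : ∀ c : ℕ, gotzmannList c 0 (List.ofFn b) = ∑ j : Fin r,
      polyBinom (((b j : ℤ)) + c - ((j : ℕ) : ℤ)) ((b j : ℤ) + c) := by
    intro c
    simp [gotzmannList_ofFn]
  have hsorted : (List.ofFn b).Pairwise (· ≥ ·) := by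
    rw [List.pairwise_ofFn]
    exact fun i j hij => Nat.cast_le.1 (hb hij.le)
  have heq : bs = List.ofFn b := by
    refine gotzmannList_injective 0 _ _ hbs hsorted
      (Polynomial.eq_of_eventually_eval_natCast_eq _ _ (max N N') fun i hi => ?_)
    have h0 := (hN i (le_of_max_le_left hi)).1
    have h1 := hN' i (le_of_max_le_right hi)
    rw [hilbFn_span_monomial] at h1
    have h2 := hg 0
    simp only [Nat.cast_zero, add_zero] at h2
    rw [h2]
    rw [gotzmannSum] at h1
    rw [← h1]
    have h3 := eval_gotzmannList 0 0 bs i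
    rw [Int.cast_natCast] at h3
    rw [h3, Nat.cast_zero, sub_zero, ← hv0, ← h0, Int.cast_natCast]
  subst heq
  refine ⟨m, N, fun i hi => ?_⟩
  have h0 := (hN i hi).2
  have h2 := hg 1
  rw [Nat.cast_one] at h2
  have h3 := eval_gotzmannList 1 0 (List.ofFn b) i
  rw [Int.cast_natCast, Nat.cast_zero, sub_zero] at h3
  rw [map_rename_span_monomial, hilbFn_span_monomial, card_stdMonomials_castSucc _ _
    (mem_upperSetOf_mapDomain_castSucc S), ← h2, Polynomial.eval_add, Polynomial.eval_C, h3,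
    ← Int.cast_natCast (R := ℚ) (∑ d ∈ Finset.range (i + 1), _), h0, hv1]
  push_cast
  ring
end

section
/- Let k be a field and I ⊊ k[x_0,…,x_n] a proper Borel monomial ideal with (finite) set G of minimal monomial generators. Then, as formal power series, (1−T)^{n+1} · Σ_{i≥0} dim_k (k[x_0,…,x_n]/I)_i · T^i = 1 − Σ_{g∈G} T^{deg g} (1−T)^{max g}; in particular, the K-polynomial hk_I of k[x_0,…,x_n]/I satisfies deg hk_I ≤ max_{g∈G} (deg g + max g). -/
/-- `u` is (the exponent vector of) a minimal monomial generator of `I`: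
`x^u ∈ I` and `x^u/x_i ∉ I` for every variable `x_i` dividing `x^u`. -/
def MinGen {k : Type*} [Field k] {N : ℕ} (I : Ideal (MvPolynomial (Fin N) k))
    (u : Fin N →₀ ℕ) : Prop :=
  MvPolynomial.monomial u (1 : k) ∈ I ∧
    ∀ i : Fin N, u i ≠ 0 → MvPolynomial.monomial (u - Finsupp.single i 1) (1 : k) ∉ I

/-- The degree of the monomial with exponent vector `u`. -/
def degOf {N : ℕ} (u : Fin N →₀ ℕ) : ℕ := ∑ i, u i

/-- `max u`: the largest index of a variable dividing the monomial `x^u`. -/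
def maxVar {N : ℕ} (u : Fin N →₀ ℕ) : ℕ := u.support.sup fun i => (i : ℕ)

/-- The exponent vectors in `S` of degree `i`. -/
def degPart {N : ℕ} (S : Set (Fin N →₀ ℕ)) (i : ℕ) : Set (Fin N →₀ ℕ) :=
  {w | w ∈ S ∧ degOf w = i}

/-- The generating function counting the exponent vectors in `S` by degree. -/
noncomputable def genFn {N : ℕ} (S : Set (Fin N →₀ ℕ)) : PowerSeries ℤ :=
  PowerSeries.mk fun i => ((degPart S i).ncard : ℤ)

/-- The exponent vectors involving only variables of index at least `m`. -/
def tailVecs (N m : ℕ) : Set (Fin N →₀ ℕ) :=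
  {w | ∀ i : Fin N, (i : ℕ) < m → w i = 0}

theorem degOf_add {N : ℕ} (u v : Fin N →₀ ℕ) : degOf (u + v) = degOf u + degOf v := by
  simp [degOf, Finset.sum_add_distrib]

theorem degOf_single {N : ℕ} (i : Fin N) (a : ℕ) : degOf (Finsupp.single i a) = a := by
  simp [degOf, Finsupp.single_apply]

theorem degOf_eq_degree {N : ℕ} (u : Fin N →₀ ℕ) : degOf u = u.degree := by
  rw [Finsupp.degree_eq_sum, degOf]

theorem degPart_finite {N : ℕ} (S : Set (Fin N →₀ ℕ)) (i : ℕ) : (degPart S i).Finite := by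
  refine (Finset.finite_toSet (Finset.univ.finsuppAntidiag i)).subset ?_
  rintro w ⟨-, hw⟩
  simpa [Finset.mem_finsuppAntidiag, degOf] using hw

theorem genFn_union {N : ℕ} {S T : Set (Fin N →₀ ℕ)} (h : Disjoint S T) :
    genFn (S ∪ T) = genFn S + genFn T := by
  ext i
  simp only [genFn, PowerSeries.coeff_mk, map_add]
  rw [← Nat.cast_add, ← Set.ncard_union_eq _ (degPart_finite S i) (degPart_finite T i)]
  · congr 2
    ext w
    simp only [degPart, Set.mem_union, Set.mem_ofPred_eq]
    tauto
  · exact h.mono (fun _ hw => hw.1) (fun _ hw => hw.1)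

theorem genFn_empty {N : ℕ} : genFn (∅ : Set (Fin N →₀ ℕ)) = 0 := by
  ext i
  simp [genFn, degPart]

theorem genFn_biUnion {N : ℕ} {ι : Type*} (G : Finset ι) (S : ι → Set (Fin N →₀ ℕ))
    (h : (G : Set ι).PairwiseDisjoint S) :
    genFn (⋃ u ∈ G, S u) = ∑ u ∈ G, genFn (S u) := by
  classical
  induction G using Finset.induction_on with
  | empty => simp [genFn_empty]
  | insert a G ha ih =>
    rw [Finset.set_biUnion_insert, Finset.sum_insert ha, genFn_union, ih]
    · exact h.subset (by simp)
    · rw [Set.disjoint_iUnion₂_right]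
      intro u hu
      exact h (by simp) (by simp [hu]) (by rintro rfl; exact ha hu)

theorem genFn_translate {N : ℕ} (u : Fin N →₀ ℕ) (S : Set (Fin N →₀ ℕ)) :
    genFn ((u + ·) '' S) = PowerSeries.X ^ degOf u * genFn S := by
  ext i
  rw [PowerSeries.coeff_X_pow_mul']
  simp only [genFn, PowerSeries.coeff_mk]
  split_ifs with h
  · rw [← Set.ncard_image_of_injective (degPart S (i - degOf u)) (add_right_injective u)]
    congr 2
    ext w
    simp only [degPart, Set.mem_image, Set.mem_ofPred_eq]
    constructor
    · rintro ⟨⟨v, hv, rfl⟩, hw⟩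
      rw [degOf_add] at hw
      exact ⟨v, ⟨hv, by omega⟩, rfl⟩
    · rintro ⟨v, ⟨hv, hd⟩, rfl⟩
      exact ⟨⟨v, hv, rfl⟩, by rw [degOf_add]; omega⟩
  · have : degPart ((u + ·) '' S) i = ∅ := by
      rw [Set.eq_empty_iff_forall_notMem]
      rintro _ ⟨⟨v, hv, rfl⟩, hw⟩
      simp only [degOf_add] at hw
      omega
    simp [this]

theorem genFn_tailVecs_self (N : ℕ) : genFn (tailVecs N N) = 1 := by
  have h : tailVecs N N = {0} := by
    ext w
    simp only [tailVecs, Set.mem_ofPred_eq, Set.mem_singleton_iff, Finsupp.ext_iff]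
    exact ⟨fun h i => h i i.2, fun h i _ => h i⟩
  ext i
  rw [h, PowerSeries.coeff_one, genFn, PowerSeries.coeff_mk]
  have h0 : degOf (0 : Fin N →₀ ℕ) = 0 := by simp [degOf]
  split_ifs with hi
  · subst hi
    have : degPart ({0} : Set (Fin N →₀ ℕ)) 0 = {0} := by
      ext w
      simp only [degPart, Set.mem_singleton_iff, Set.mem_ofPred_eq, and_iff_left_iff_imp]
      rintro rfl
      exact h0
    simp [this]
  · have : degPart ({0} : Set (Fin N →₀ ℕ)) i = ∅ := by
      rw [Set.eq_empty_iff_forall_notMem]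
      rintro w ⟨hw, hd⟩
      rw [Set.mem_singleton_iff.1 hw, h0] at hd
      exact hi hd.symm
    simp [this]

theorem genFn_tailVecs_succ {N m : ℕ} (hm : m < N) :
    genFn (tailVecs N (m + 1)) = (1 - PowerSeries.X) * genFn (tailVecs N m) := by
  have h : tailVecs N m =
      tailVecs N (m + 1) ∪ (Finsupp.single ⟨m, hm⟩ 1 + ·) '' tailVecs N m := by
    ext w
    simp only [tailVecs, Set.mem_union, Set.mem_image, Set.mem_ofPred_eq]
    constructor
    · intro hw
      by_cases h0 : w ⟨m, hm⟩ = 0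
      · left
        intro i hi
        rcases Nat.lt_succ_iff_lt_or_eq.1 hi with hi | hi
        · exact hw i hi
        · rwa [show i = ⟨m, hm⟩ from Fin.ext hi]
      · right
        refine ⟨w - Finsupp.single ⟨m, hm⟩ 1, fun i hi => by simp [hw i hi], ?_⟩
        exact add_tsub_cancel_of_le (Finsupp.single_le_iff.2 (Nat.one_le_iff_ne_zero.2 h0))
    · rintro (hw | ⟨v, hv, rfl⟩) i hi
      · exact hw i (by omega)
      · have : (⟨m, hm⟩ : Fin N) ≠ i := by rintro rfl; simp at hi
        simp [hv i hi, this]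
  have hd : Disjoint (tailVecs N (m + 1))
      ((Finsupp.single ⟨m, hm⟩ 1 + ·) '' tailVecs N m) := by
    rw [Set.disjoint_left]
    rintro _ hw ⟨v, -, rfl⟩
    have := hw ⟨m, hm⟩ (Nat.lt_succ_self m)
    simp at this
  have key := genFn_union hd
  rw [← h, genFn_translate, degOf_single, pow_one] at key
  linear_combination -key

theorem genFn_tailVecs {N m : ℕ} (hm : m ≤ N) :
    genFn (tailVecs N m) = (1 - PowerSeries.X) ^ m * genFn (Set.univ : Set (Fin N →₀ ℕ)) := by
  induction m with
  | zero => simp [tailVecs]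
  | succ m ih => rw [genFn_tailVecs_succ hm, ih (by omega), pow_succ]; ring

theorem one_sub_X_pow_mul_genFn_univ (N : ℕ) :
    (1 - PowerSeries.X) ^ N * genFn (Set.univ : Set (Fin N →₀ ℕ)) = 1 := by
  rw [← genFn_tailVecs le_rfl, genFn_tailVecs_self]

section MonomialIdeal

variable {k : Type*} [Field k] {N : ℕ} {I : Ideal (MvPolynomial (Fin N) k)}

/-- The exponent vectors of the monomials in `I`. -/
def expSet (I : Ideal (MvPolynomial (Fin N) k)) : Set (Fin N →₀ ℕ) :=
  {w | MvPolynomial.monomial w (1 : k) ∈ I}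

theorem expSet_of_le {u w : Fin N →₀ ℕ} (h : u ≤ w) (hu : u ∈ expSet I) : w ∈ expSet I := by
  have := I.mul_mem_left (MvPolynomial.monomial (w - u) 1) hu
  rwa [MvPolynomial.monomial_mul, one_mul, tsub_add_cancel_of_le h] at this

theorem IsMonomialIdeal.mem_iff (hmon : IsMonomialIdeal I) (p : MvPolynomial (Fin N) k) :
    p ∈ I ↔ ∀ w ∈ p.support, w ∈ expSet I := by
  constructor
  · obtain ⟨S, rfl⟩ := hmon
    intro hp w hw
    obtain ⟨s, hs, hsw⟩ := MvPolynomial.mem_ideal_span_monomial_image.1 hp w hw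
    exact expSet_of_le hsw (Ideal.subset_span ⟨s, hs, rfl⟩)
  · intro h
    rw [p.as_sum]
    refine I.sum_mem fun w hw => ?_
    have := I.mul_mem_left (MvPolynomial.C (p.coeff w)) (h w hw)
    rwa [MvPolynomial.C_mul_monomial, mul_one] at this

theorem hilbFn_eq_ncard (hmon : IsMonomialIdeal I) (i : ℕ) :
    hilbFn I i = (degPart (expSet I)ᶜ i).ncard := by
  classical
  have := (degPart_finite (expSet I)ᶜ i).fintype
  let V := MvPolynomial.homogeneousSubmodule (Fin N) k i
  let f : V →ₗ[k] (degPart (expSet I)ᶜ i → k) :=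
    LinearMap.pi fun w => (MvPolynomial.lcoeff k w.1).comp V.subtype
  have hf : ∀ p w, f p w = MvPolynomial.coeff w.1 p.1 := fun p w => rfl
  have hker : LinearMap.ker f = Submodule.comap V.subtype (Submodule.restrictScalars k I) := by
    ext p
    simp only [LinearMap.mem_ker, Submodule.mem_comap, Submodule.restrictScalars_mem,
      Submodule.subtype_apply]
    rw [hmon.mem_iff]
    constructor
    · intro h w hw
      by_contra hwI
      have hd : degOf w = i := by
        rw [degOf_eq_degree, Finsupp.degree_eq_weight_one]
        exact p.2 (MvPolynomial.mem_support_iff.1 hw)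
      exact MvPolynomial.mem_support_iff.1 hw (congrFun h ⟨w, hwI, hd⟩)
    · intro h
      ext w
      rw [hf]
      by_contra hw
      exact w.2.1 (h w.1 (MvPolynomial.mem_support_iff.2 hw))
  have hsurj : Function.Surjective f := by
    intro g
    have hmem : ∑ w, MvPolynomial.monomial w.1 (g w) ∈ V := by
      refine V.sum_mem fun w _ => MvPolynomial.isHomogeneous_monomial _ ?_
      rw [← degOf_eq_degree]
      exact w.2.2
    refine ⟨⟨_, hmem⟩, ?_⟩
    ext w
    rw [hf, MvPolynomial.coeff_sum]
    simp [MvPolynomial.coeff_monomial, Subtype.coe_inj]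
  rw [hilbFn, ← hker, (f.quotKerEquivOfSurjective hsurj).finrank_eq,
    Module.finrank_fintype_fun_eq_card, ← Nat.card_eq_fintype_card, Set.ncard_def,
    Nat.card_coe_set_eq, Set.ncard_def]

theorem le_maxVar {u : Fin N →₀ ℕ} {i : Fin N} (h : u i ≠ 0) : (i : ℕ) ≤ maxVar u :=
  Finset.le_sup (f := fun i : Fin N => (i : ℕ)) (Finsupp.mem_support_iff.2 h)

theorem eq_zero_of_maxVar_lt {u : Fin N →₀ ℕ} {i : Fin N} (h : maxVar u < i) : u i = 0 := by
  by_contra h0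
  exact absurd (le_maxVar h0) (by omega)

theorem exists_eq_maxVar {u : Fin N →₀ ℕ} (h : u ≠ 0) :
    ∃ j : Fin N, u j ≠ 0 ∧ (j : ℕ) = maxVar u := by
  obtain ⟨j, hj, hj'⟩ := Finset.exists_mem_eq_sup u.support (Finsupp.support_nonempty_iff.2 h)
    (fun i : Fin N => (i : ℕ))
  exact ⟨j, Finsupp.mem_support_iff.1 hj, hj'.symm⟩

theorem MinGen.eq_of_le {u v : Fin N →₀ ℕ} (hu : MinGen I u) (hv : MinGen I v) (h : u ≤ v) :
    u = v := by
  by_contra hne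
  obtain ⟨i, hi⟩ := Finsupp.ne_iff.1 hne
  have hlt : u i < v i := lt_of_le_of_ne (h i) hi
  refine hv.2 i (by omega) (expSet_of_le (I := I) (u := u) ?_ hu.1)
  intro j
  have := h j
  by_cases hij : i = j
  · subst hij
    simp only [Finsupp.coe_tsub, Pi.sub_apply, Finsupp.single_eq_same]
    omega
  · simpa [Finsupp.single_apply, hij] using this

theorem IsBorel.sub_single_maxVar_mem (hI : IsBorel I) {w : Fin N →₀ ℕ} {i j : Fin N}
    (hi : w i ≠ 0) (hwi : w - Finsupp.single i 1 ∈ expSet I)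
    (hj : w j ≠ 0) (hjm : (j : ℕ) = maxVar w) : w - Finsupp.single j 1 ∈ expSet I := by
  have hij : i ≤ j := by
    rw [Fin.le_def, hjm]
    exact le_maxVar hi
  rcases hij.eq_or_lt with rfl | hij
  · exact hwi
  have h := hI _ hwi j (by simpa [Finsupp.single_apply, hij.ne] using hj) i hij
  suffices w - Finsupp.single j 1 =
      w - Finsupp.single i 1 - Finsupp.single j 1 + Finsupp.single i 1 by rwa [this]
  ext l
  simp only [Finsupp.coe_tsub, Finsupp.coe_add, Pi.sub_apply, Pi.add_apply, Finsupp.single_apply]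
  have := hij.ne
  split_ifs <;> subst_vars <;> omega

theorem IsBorel.exists_minGen_add (hI : IsBorel I) {w : Fin N →₀ ℕ} (hw : w ∈ expSet I) :
    ∃ u, MinGen I u ∧ ∃ v ∈ tailVecs N (maxVar u), u + v = w := by
  induction hd : degOf w generalizing w with
  | zero =>
    refine ⟨w, ⟨hw, fun i hi => ?_⟩, 0, by simp [tailVecs], by simp⟩
    simp only [degOf, Finset.sum_eq_zero_iff, Finset.mem_univ, true_imp_iff] at hd
    exact absurd (hd i) hi
  | succ d ih =>
    by_cases hmin : MinGen I w
    · exact ⟨w, hmin, 0, by simp [tailVecs], by simp⟩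
    obtain ⟨i, hi, hwi⟩ : ∃ i, w i ≠ 0 ∧ w - Finsupp.single i 1 ∈ expSet I := by
      by_contra! hcon
      exact hmin ⟨hw, hcon⟩
    obtain ⟨j, hj, hjm⟩ := exists_eq_maxVar (u := w) (by rintro rfl; simp at hi)
    have hwj := hI.sub_single_maxVar_mem hi hwi hj hjm
    have hsum : w - Finsupp.single j 1 + Finsupp.single j 1 = w :=
      tsub_add_cancel_of_le (Finsupp.single_le_iff.2 (Nat.one_le_iff_ne_zero.2 hj))
    obtain ⟨u, hu, v, hv, huv⟩ := ih hwj (by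
      have := degOf_add (w - Finsupp.single j 1) (Finsupp.single j 1)
      rw [hsum, degOf_single] at this
      omega)
    refine ⟨u, hu, v + Finsupp.single j 1, ?_, by rw [← add_assoc, huv, hsum]⟩
    have hle : maxVar u ≤ j := by
      refine Finset.sup_le fun l hl => ?_
      rw [hjm]
      refine le_maxVar (u := w) ?_
      rw [← hsum, ← huv]
      simp only [Finsupp.coe_add, Pi.add_apply]
      have := Finsupp.mem_support_iff.1 hl
      omega
    intro l hl
    have : j ≠ l := by rintro rfl; omega
    simp [hv l hl, this]

theorem MinGen.eq_of_add_eq {u v u' v' : Fin N →₀ ℕ} (hu : MinGen I u) (hu' : MinGen I u')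
    (hv : v ∈ tailVecs N (maxVar u)) (hv' : v' ∈ tailVecs N (maxVar u'))
    (h : u + v = u' + v') : u = u' := by
  have hle : ∀ {u v u' v' : Fin N →₀ ℕ}, v' ∈ tailVecs N (maxVar u') → u + v = u' + v' →
      (maxVar u < maxVar u' ∨
        maxVar u = maxVar u' ∧ ∀ l : Fin N, (l : ℕ) = maxVar u → u l ≤ u' l) → u ≤ u' := by
    intro u v u' v' hv' h hmax l
    have hl := DFunLike.congr_fun h l
    simp only [Finsupp.coe_add, Pi.add_apply] at hl
    rcases lt_trichotomy (l : ℕ) (maxVar u) with h1 | h1 | h1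
    · have := hv' l (by omega)
      omega
    · rcases hmax with h2 | ⟨-, h2⟩
      · have := hv' l (by omega)
        omega
      · exact h2 l h1
    · simp [eq_zero_of_maxVar_lt h1]
  rcases lt_trichotomy (maxVar u) (maxVar u') with h1 | h1 | h1
  · exact hu.eq_of_le hu' (hle hv' h (Or.inl h1))
  · by_cases h2 : ∀ l : Fin N, (l : ℕ) = maxVar u → u l ≤ u' l
    · exact hu.eq_of_le hu' (hle hv' h (Or.inr ⟨h1, h2⟩))
    · push Not at h2
      obtain ⟨l, hl, hlt⟩ := h2
      refine (hu'.eq_of_le hu (hle hv h.symm (Or.inr ⟨h1.symm, fun l' hl' => ?_⟩))).symm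
      rw [show l' = l from Fin.ext (by omega)]
      exact hlt.le
  · exact (hu'.eq_of_le hu (hle hv h.symm (Or.inl h1))).symm

/-- The Eliahou–Kervaire decomposition of the monomials in a Borel ideal. -/
theorem IsBorel.genFn_expSet (hI : IsBorel I) (G : Finset (Fin N →₀ ℕ))
    (hG : ∀ u, u ∈ G ↔ MinGen I u) :
    genFn (expSet I) = ∑ u ∈ G, PowerSeries.X ^ degOf u * genFn (tailVecs N (maxVar u)) := by
  have h : expSet I = ⋃ u ∈ G, (u + ·) '' tailVecs N (maxVar u) := by
    ext w
    simp only [Set.mem_iUnion, exists_prop, hG, Set.mem_image]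
    constructor
    · exact hI.exists_minGen_add
    · rintro ⟨u, hu, v, -, rfl⟩
      exact expSet_of_le le_self_add hu.1
  rw [h, genFn_biUnion]
  · simp only [genFn_translate]
  · intro u hu u' hu' hne
    rw [Function.onFun, Set.disjoint_left]
    rintro _ ⟨v, hv, rfl⟩ ⟨v', hv', h⟩
    exact hne (((hG u).1 hu).eq_of_add_eq ((hG u').1 hu') hv hv' h.symm)

end MonomialIdeal

theorem maxVar_le {n : ℕ} (u : Fin (n + 1) →₀ ℕ) : maxVar u ≤ n :=
  Finset.sup_le fun i _ => Nat.le_of_lt_succ i.2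

theorem degree_one_sub_sum_le {ι : Type*} (G : Finset ι) (a b : ι → ℕ) :
    (1 - ∑ u ∈ G, Polynomial.X ^ a u * (1 - Polynomial.X) ^ b u : Polynomial ℤ).degree
      ≤ ((G.sup fun u => a u + b u : ℕ) : WithBot ℕ) := by
  rw [← Polynomial.natDegree_le_iff_degree_le]
  refine (Polynomial.natDegree_sub_le _ _).trans (max_le (by simp) ?_)
  refine Polynomial.natDegree_sum_le_of_forall_le G _ fun u hu => ?_
  refine le_trans ?_ (Finset.le_sup (f := fun u => a u + b u) hu)
  have h1 : (1 - Polynomial.X : Polynomial ℤ).natDegree ≤ 1 := by compute_degree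
  refine Polynomial.natDegree_mul_le_of_le (Polynomial.natDegree_X_pow_le _) ?_
  simpa using Polynomial.natDegree_pow_le_of_le (b u) h1

/-- For a proper Borel monomial ideal `I` with finite set `G` of minimal monomial
generators, `(1−T)^{n+1}·Σ_i dim_k (k[x]/I)_i T^i = 1 − Σ_{g∈G} T^{deg g}(1−T)^{max g}`
as formal power series; in particular the K-polynomial of `k[x]/I` has degree at most
`max_{g∈G} (deg g + max g)`. -/
theorem statement_14 (k : Type*) [Field k] (n : ℕ)
    (I : Ideal (MvPolynomial (Fin (n + 1)) k))
    (hmon : IsMonomialIdeal I) (hborel : IsBorel I) (hproper : I ≠ ⊤)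
    (G : Finset (Fin (n + 1) →₀ ℕ)) (hG : ∀ u, u ∈ G ↔ MinGen I u) :
    ((1 - PowerSeries.X : PowerSeries ℤ) ^ (n + 1) *
        PowerSeries.mk (fun i => (hilbFn I i : ℤ))
      = ((1 - ∑ u ∈ G, Polynomial.X ^ degOf u * (1 - Polynomial.X) ^ maxVar u :
          Polynomial ℤ) : PowerSeries ℤ)) ∧
    (1 - ∑ u ∈ G, Polynomial.X ^ degOf u * (1 - Polynomial.X) ^ maxVar u :
        Polynomial ℤ).degree
      ≤ ((G.sup fun u => degOf u + maxVar u : ℕ) : WithBot ℕ) := by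
  refine ⟨?_, degree_one_sub_sum_le G degOf maxVar⟩
  have hH : PowerSeries.mk (fun i => (hilbFn I i : ℤ)) = genFn (expSet I)ᶜ := by
    simp only [genFn, hilbFn_eq_ncard hmon]
  have hsplit := genFn_union (disjoint_compl_right (a := expSet I))
  have htail : ∀ u ∈ G, PowerSeries.X ^ degOf u * genFn (tailVecs (n + 1) (maxVar u)) =
      PowerSeries.X ^ degOf u * (1 - PowerSeries.X) ^ maxVar u * genFn Set.univ := fun u _ => by
    rw [genFn_tailVecs ((maxVar_le u).trans n.le_succ), mul_assoc]
  rw [Set.union_compl_self, hborel.genFn_expSet G hG, Finset.sum_congr rfl htail,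
    ← Finset.sum_mul] at hsplit
  have hone := one_sub_X_pow_mul_genFn_univ (n + 1)
  have hcoe : ((1 - ∑ u ∈ G, Polynomial.X ^ degOf u * (1 - Polynomial.X) ^ maxVar u :
      Polynomial ℤ) : PowerSeries ℤ) =
      1 - ∑ u ∈ G, PowerSeries.X ^ degOf u * (1 - PowerSeries.X) ^ maxVar u := by
    simp only [← Polynomial.coeToPowerSeries.ringHom_apply, map_sub, map_one, map_sum, map_mul,
      map_pow]
    simp only [Polynomial.coeToPowerSeries.ringHom_apply, Polynomial.coe_X]
  rw [hH, hcoe]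
  linear_combination
    (1 - ∑ u ∈ G, PowerSeries.X ^ degOf u * (1 - PowerSeries.X) ^ maxVar u) * hone
      - (1 - PowerSeries.X) ^ (n + 1) * hsplit
end
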